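/- Let r > 0, θ ∈ ℝ, σ > 0, and let h : ℝ → ℝ be Lipschitz with constant L ≥ 0 (so |h(u)−h(v)| ≤ L|u−v| for all u,v). Let f_h be the solution of the VG(r,θ,σ,0) Stein equation with test function h. Then for every x ≠ 0, |f_h(x)| ≤ {4 + 2√2/√r + √(2π(r+1))·(|θ|/σ)·(1+θ²/σ²)^{(r−1)/2} + (√(2r)+r)·A(r,θ,σ)}·L. -/

import Mathlib

open MeasureTheory Real Filter

/-- Modified Bessel function of the second kind. -/
noncomputable def besselK (ν x : ℝ) : ℝ :=
  ∫ t in Set.Ioi (0:ℝ), Real.exp (-x * Real.cosh t) * Real.cosh (ν * t)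

/-- Modified Bessel function of the first kind. -/
noncomputable def besselI (ν x : ℝ) : ℝ :=
  ∑' k : ℕ, (x / 2) ^ (ν + 2 * (k : ℝ)) / (Real.Gamma (ν + (k : ℝ) + 1) * (Nat.factorial k))

/-- The VG(r,θ,σ,0) density. -/
noncomputable def vgDensity (r θ σ x : ℝ) : ℝ :=
  (σ * Real.sqrt Real.pi * Real.Gamma (r / 2))⁻¹ * Real.exp (θ * x / σ ^ 2) *
    (|x| / (2 * Real.sqrt (θ ^ 2 + σ ^ 2))) ^ ((r - 1) / 2) *
    besselK ((r - 1) / 2) (Real.sqrt (θ ^ 2 + σ ^ 2) * |x| / σ ^ 2)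

/-- The centred test function h̃(x) = h(x) − E h(Z). -/
noncomputable def htilde (r θ σ : ℝ) (h : ℝ → ℝ) (x : ℝ) : ℝ :=
  h x - ∫ t, h t * vgDensity r θ σ t

/-- The solution of the VG(r,θ,σ,0) Stein equation with test function h. -/
noncomputable def steinSolution (r θ σ : ℝ) (h : ℝ → ℝ) (x : ℝ) : ℝ :=
  -(Real.exp (-(θ / σ ^ 2) * x) *
      besselK ((r - 1) / 2) (Real.sqrt (θ ^ 2 + σ ^ 2) / σ ^ 2 * |x|) /
      (σ ^ 2 * |x| ^ ((r - 1) / 2))) *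
    (∫ t in (0:ℝ)..x, Real.exp ((θ / σ ^ 2) * t) * |t| ^ ((r - 1) / 2) *
      besselI ((r - 1) / 2) (Real.sqrt (θ ^ 2 + σ ^ 2) / σ ^ 2 * |t|) * htilde r θ σ h t) -
  (Real.exp (-(θ / σ ^ 2) * x) *
      besselI ((r - 1) / 2) (Real.sqrt (θ ^ 2 + σ ^ 2) / σ ^ 2 * |x|) /
      (σ ^ 2 * |x| ^ ((r - 1) / 2))) *
    (∫ t in Set.Ioi x, Real.exp ((θ / σ ^ 2) * t) * |t| ^ ((r - 1) / 2) *
      besselK ((r - 1) / 2) (Real.sqrt (θ ^ 2 + σ ^ 2) / σ ^ 2 * |t|) * htilde r θ σ h t)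

/-- The constant A(r,θ,σ). -/
noncomputable def Aconst (r θ σ : ℝ) : ℝ :=
  if 2 ≤ r then 2 * Real.sqrt Real.pi / Real.sqrt (2 * r - 1) * (1 + θ ^ 2 / σ ^ 2) ^ (r / 2)
  else 12 * Real.Gamma (r / 2) * (1 + θ ^ 2 / σ ^ 2)

/-- The constant B(r,θ,σ). -/
noncomputable def Bconst (r θ σ : ℝ) : ℝ :=
  if 2 ≤ r then Real.sqrt (Real.pi * (r - 1) / 2) * (1 + θ ^ 2 / σ ^ 2) ^ (r / 2 - 1)
  else 2

/-- The constant C(r,θ,σ). -/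
noncomputable def Cconst (r θ σ : ℝ) : ℝ :=
  6 + 2 * Real.sqrt 2 / Real.sqrt r +
    2 * Real.sqrt (2 * Real.pi * (r + 1)) * (|θ| / σ) * (1 + θ ^ 2 / σ ^ 2) ^ ((r - 1) / 2) +
    2 * (Real.sqrt (2 * r) + r) * Aconst r θ σ


lemma int_Ioi_lim {f f' : ℝ → ℝ} {m : ℝ} (hd : ∀ x ∈ Set.Ioi (0:ℝ), HasDerivAt f (f' x) x)
    (hf' : IntegrableOn f' (Set.Ioi 0)) (hf : IntegrableOn f (Set.Ioi 0))
    (h0 : Tendsto f (nhdsWithin 0 (Set.Ioi 0)) (nhds m)) :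
    ∫ x in Set.Ioi (0:ℝ), f' x = -m := by
  have hinf := tendsto_zero_of_hasDerivAt_of_integrableOn_Ioi hd hf' hf
  have hne : ∀ x ∈ Set.Ioi (0:ℝ), Function.update f 0 m =ᶠ[nhds x] f := by
    intro x hx
    filter_upwards [Ioi_mem_nhds hx] with y hy
    exact Function.update_of_ne (ne_of_gt hy) _ _
  have := integral_Ioi_of_hasDerivAt_of_tendsto (f := Function.update f 0 m) (f' := f') (a := 0)
    (m := 0) ?_ ?_ hf' ?_
  · simpa using this
  · rw [← continuousWithinAt_Ioi_iff_Ici, continuousWithinAt_update_same]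
    simpa using h0
  · intro x hx
    exact (hd x hx).congr_of_eventuallyEq (hne x hx)
  · refine hinf.congr' ?_
    filter_upwards [Ioi_mem_atTop 0] with y hy
    exact (Function.update_of_ne (ne_of_gt hy) _ _).symm

noncomputable def jker (μ z s : ℝ) : ℝ := s ^ (μ - 1) * Real.exp (-s - z / s)

noncomputable def jj (μ z : ℝ) : ℝ := ∫ s in Set.Ioi (0:ℝ), jker μ z s

lemma jker_pos (μ z : ℝ) {s : ℝ} (hs : 0 < s) : 0 < jker μ z s := by
  unfold jker; positivity

lemma jker_meas (μ z : ℝ) : Measurable (jker μ z) := by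
  unfold jker
  fun_prop

lemma gamma_integrable {μ : ℝ} (hμ : 0 < μ) :
    IntegrableOn (fun s : ℝ => s ^ (μ - 1) * Real.exp (-s)) (Set.Ioi 0) := by
  refine (Real.GammaIntegral_convergent hμ).congr_fun (fun x _ => by ring) measurableSet_Ioi

lemma exp_neg_div_le (n : ℕ) {z s : ℝ} (hz : 0 < z) (hs : 0 < s) :
    Real.exp (-(z / s)) ≤ n.factorial * z⁻¹ ^ n * s ^ n := by
  have h := Real.pow_div_factorial_le_exp (x := z / s) (by positivity) n
  rw [Real.exp_neg]
  have h1 : (0:ℝ) < n.factorial := by positivity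
  have h2 : 0 < (z / s) ^ n / n.factorial := by positivity
  calc (Real.exp (z / s))⁻¹ ≤ ((z / s) ^ n / n.factorial)⁻¹ := inv_anti₀ h2 h
    _ = _ := by rw [div_pow, inv_pow]; field_simp

lemma jker_le (μ : ℝ) (n : ℕ) {z s : ℝ} (hz : 0 < z) (hs : 0 < s) :
    jker μ z s ≤ (n.factorial * z⁻¹ ^ n) * (s ^ (μ + n - 1) * Real.exp (-s)) := by
  unfold jker
  rw [sub_eq_add_neg (-s), Real.exp_add]
  have h := exp_neg_div_le n hz hs
  have e : s ^ (μ + n - 1) = s ^ (μ - 1) * s ^ n := by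
    rw [← Real.rpow_natCast, ← Real.rpow_add hs]; ring_nf
  rw [e]
  have : 0 < s ^ (μ - 1) * Real.exp (-s) := by positivity
  nlinarith [mul_le_mul_of_nonneg_left h this.le]

lemma jker_integrable_pos {μ z : ℝ} (hz : 0 < z) : IntegrableOn (jker μ z) (Set.Ioi 0) := by
  obtain ⟨n, hn⟩ := exists_nat_gt (-μ)
  have hi := (gamma_integrable (μ := μ + n) (by linarith)).const_mul (n.factorial * z⁻¹ ^ n)
  refine Integrable.mono' hi (jker_meas μ z).aestronglyMeasurable ?_
  filter_upwards [self_mem_ae_restrict measurableSet_Ioi] with s hs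
  rw [Real.norm_of_nonneg (jker_pos μ z hs).le]
  exact jker_le μ n hz hs

lemma jker_le_zero (μ : ℝ) {z s : ℝ} (hz : 0 ≤ z) (hs : 0 < s) :
    jker μ z s ≤ s ^ (μ - 1) * Real.exp (-s) := by
  unfold jker
  gcongr
  have : 0 ≤ z / s := by positivity
  linarith

lemma jj_pos {μ z : ℝ} (hz : 0 < z) : 0 < jj μ z := by
  unfold jj
  rw [setIntegral_pos_iff_support_of_nonneg_ae]
  · have : Function.support (jker μ z) ∩ Set.Ioi 0 = Set.Ioi 0 := by
      rw [Set.inter_eq_right]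
      intro s hs
      exact (jker_pos μ z hs).ne'
    rw [this]; simp
  · filter_upwards [self_mem_ae_restrict measurableSet_Ioi] with s hs
    exact (jker_pos μ z hs).le
  · exact jker_integrable_pos hz

lemma jj_hasDerivAt (μ : ℝ) {z : ℝ} (hz : 0 < z) : HasDerivAt (jj μ) (-jj (μ - 1) z) z := by
  have key := hasDerivAt_integral_of_dominated_loc_of_deriv_le
    (μ := volume.restrict (Set.Ioi (0:ℝ))) (F := jker μ) (F' := fun z s => -jker (μ - 1) z s)
    (x₀ := z) (s := Set.Ioi (z / 2)) (bound := jker (μ - 1) (z / 2))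
    (Ioi_mem_nhds (by linarith)) (Eventually.of_forall fun y => (jker_meas μ y).aestronglyMeasurable)
    (jker_integrable_pos hz) (jker_meas _ z).neg.aestronglyMeasurable ?_
    (jker_integrable_pos (by linarith)) ?_
  · have h2 := key.2
    rw [integral_neg] at h2
    exact h2
  · filter_upwards [self_mem_ae_restrict measurableSet_Ioi] with s hs y hy
    rw [norm_neg, Real.norm_of_nonneg (jker_pos _ _ hs).le]
    unfold jker
    have hs' : (0:ℝ) < s := hs
    have hy' : z / 2 < y := hy
    gcongr
  · filter_upwards [self_mem_ae_restrict measurableSet_Ioi] with s hs y hy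
    have hs' : (0:ℝ) < s := hs
    unfold jker
    have h1 : HasDerivAt (fun y : ℝ => -s - y / s) (-(1 / s)) y := by
      simpa using ((hasDerivAt_id y).div_const s).const_sub (-s)
    have h2 := (h1.exp).const_mul (s ^ (μ - 1))
    refine h2.congr_deriv ?_
    have e : s ^ (μ - 1) = s ^ (μ - 1 - 1) * s := by
      rw [Real.rpow_sub_one hs'.ne' (μ - 1)]; field_simp
    rw [e]; field_simp

lemma jj_rec (μ : ℝ) {z : ℝ} (hz : 0 < z) : jj (μ + 1) z = μ * jj μ z + z * jj (μ - 1) z := by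
  have hd : ∀ s ∈ Set.Ioi (0:ℝ), HasDerivAt (jker (μ + 1) z)
      (μ * jker μ z s - jker (μ + 1) z s + z * jker (μ - 1) z s) s := by
    intro s hs
    have hs' : (0:ℝ) < s := hs
    unfold jker
    have h1 : HasDerivAt (fun s : ℝ => -s - z / s) (-1 + z / s ^ 2) s := by
      have := ((hasDerivAt_id s).neg).sub ((hasDerivAt_inv hs'.ne').const_mul z)
      refine (this.congr_deriv ?_)
      simp [div_eq_mul_inv]
    have h2 := (Real.hasDerivAt_rpow_const (p := μ + 1 - 1) (Or.inl hs'.ne')).mul h1.exp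
    refine h2.congr_deriv ?_
    have e1 : s ^ (μ - 1) = s ^ (μ - 1 - 1) * s := by
      rw [Real.rpow_sub_one hs'.ne' (μ - 1)]; field_simp
    have e2 : s ^ μ = s ^ (μ - 1 - 1) * s * s := by
      rw [← e1, Real.rpow_sub_one hs'.ne' μ]; field_simp
    simp only [add_sub_cancel_right]
    rw [e2, e1]; field_simp; ring
  have hint : ∀ κ, IntegrableOn (jker κ z) (Set.Ioi 0) := fun κ => jker_integrable_pos hz
  have h0 : Tendsto (jker (μ + 1) z) (nhdsWithin 0 (Set.Ioi 0)) (nhds 0) := by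
    obtain ⟨n, hn⟩ := exists_nat_gt (-μ)
    have hc : Tendsto (fun s : ℝ => (n.factorial * z⁻¹ ^ n) * (s ^ (μ + 1 + n - 1) * Real.exp (-s)))
        (nhdsWithin 0 (Set.Ioi 0)) (nhds 0) := by
      have hcont : ContinuousAt (fun s : ℝ => (n.factorial * z⁻¹ ^ n) *
          (s ^ (μ + 1 + n - 1) * Real.exp (-s))) 0 := by
        have : ContinuousAt (fun s : ℝ => s ^ (μ + 1 + n - 1)) 0 :=
          Real.continuousAt_rpow_const _ _ (Or.inr (by linarith))
        exact continuousAt_const.mul (this.mul (by fun_prop))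
      have := hcont.tendsto
      rw [Real.zero_rpow (by linarith)] at this
      simp only [zero_mul, mul_zero] at this
      exact this.mono_left nhdsWithin_le_nhds
    refine squeeze_zero' ?_ ?_ hc
    · filter_upwards [self_mem_nhdsWithin] with s hs using (jker_pos _ _ hs).le
    · filter_upwards [self_mem_nhdsWithin] with s hs using jker_le _ n hz hs
  have := int_Ioi_lim hd (((hint μ).const_mul μ |>.sub (hint _)).add ((hint _).const_mul z)) (hint _) h0
  rw [integral_add, integral_sub, integral_const_mul, integral_const_mul] at this
  · unfold jj; linarith
  · exact (hint _).const_mul _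
  · exact hint _
  · exact ((hint μ).const_mul μ |>.sub (hint _))
  · exact (hint _).const_mul _

lemma jj_tendsto {μ : ℝ} (hμ : 0 < μ) :
    Tendsto (jj μ) (nhdsWithin 0 (Set.Ioi 0)) (nhds (Real.Gamma μ)) := by
  have e : Real.Gamma μ = ∫ s in Set.Ioi (0:ℝ), s ^ (μ - 1) * Real.exp (-s) := by
    rw [Real.Gamma_eq_integral hμ]
    congr 1; ext s; ring
  rw [e]
  refine tendsto_integral_filter_of_dominated_convergence (fun s => s ^ (μ - 1) * Real.exp (-s))
    (Eventually.of_forall fun z => (jker_meas μ z).aestronglyMeasurable) ?_ (gamma_integrable hμ) ?_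
  · filter_upwards [self_mem_nhdsWithin] with z hz
    filter_upwards [self_mem_ae_restrict measurableSet_Ioi] with s hs
    rw [Real.norm_of_nonneg (jker_pos μ z hs).le]
    exact jker_le_zero μ (le_of_lt hz) hs
  · filter_upwards [self_mem_ae_restrict measurableSet_Ioi] with s hs
    have : Continuous (fun z => jker μ z s) := by unfold jker; fun_prop
    have h := this.tendsto 0
    simp only [jker, zero_div, sub_zero] at h
    exact h.mono_left nhdsWithin_le_nhds

lemma sqrt_jj_tendsto {ν : ℝ} (hν : -(1/2) < ν) :
    Tendsto (fun z => Real.sqrt z * jj ν z) (nhdsWithin 0 (Set.Ioi 0)) (nhds 0) := by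
  have e : (fun z => Real.sqrt z * jj ν z) =
      fun z => ∫ s in Set.Ioi (0:ℝ), Real.sqrt z * jker ν z s := by
    ext z; rw [integral_const_mul]; rfl
  rw [e]
  have e0 : (∫ s in Set.Ioi (0:ℝ), (0:ℝ)) = 0 := by simp
  suffices goal : Tendsto (fun z => ∫ s in Set.Ioi (0:ℝ), Real.sqrt z * jker ν z s)
      (nhdsWithin 0 (Set.Ioi 0)) (nhds (∫ s in Set.Ioi (0:ℝ), (0:ℝ))) by
    rwa [e0] at goal
  refine tendsto_integral_filter_of_dominated_convergence
    (fun s => s ^ (ν + 1/2 - 1) * Real.exp (-s))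
    (Eventually.of_forall fun z => ((jker_meas ν z).const_mul _).aestronglyMeasurable) ?_
    (gamma_integrable (by linarith)) ?_
  · filter_upwards [self_mem_nhdsWithin] with z hz
    filter_upwards [self_mem_ae_restrict measurableSet_Ioi] with s hs
    have hs' : (0:ℝ) < s := hs
    have hz' : (0:ℝ) < z := hz
    rw [Real.norm_of_nonneg (mul_nonneg (Real.sqrt_nonneg _) (jker_pos ν z hs).le)]
    unfold jker
    have e1 : s ^ (ν + 1/2 - 1) = s ^ (ν - 1) * Real.sqrt s := by
      rw [Real.sqrt_eq_rpow, ← Real.rpow_add hs']; ring_nf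
    have h1 : Real.sqrt (z / s) * Real.exp (-(z / s)) ≤ 1 := by
      have h2 : Real.sqrt (z / s) ≤ Real.exp (z / s) := by
        have h3 := Real.add_one_le_exp (z / s)
        have h4 : 0 ≤ z / s := by positivity
        have h5 := Real.sq_sqrt h4
        nlinarith [sq_nonneg (Real.sqrt (z / s) - 1)]
      rw [Real.exp_neg, ← div_eq_mul_inv, div_le_one (Real.exp_pos _)]
      exact h2
    have e2 : Real.sqrt z = Real.sqrt (z / s) * Real.sqrt s := by
      rw [← Real.sqrt_mul (by positivity)]; congr 1; field_simp
    rw [e1, sub_eq_add_neg (-s), Real.exp_add, e2]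
    have h6 : 0 ≤ s ^ (ν - 1) * Real.sqrt s * Real.exp (-s) := by positivity
    nlinarith [mul_le_mul_of_nonneg_left h1 h6]
  · filter_upwards [self_mem_ae_restrict measurableSet_Ioi] with s hs
    have : Continuous (fun z => Real.sqrt z * jker ν z s) := by unfold jker; fun_prop
    have h := this.tendsto 0
    simp only [Real.sqrt_zero, zero_mul] at h
    exact h.mono_left nhdsWithin_le_nhds



lemma besselK_eq (ν : ℝ) {x : ℝ} (hx : 0 < x) :
    besselK ν x = (1 / 2) * (x / 2) ^ (-ν) * jj ν (x ^ 2 / 4) := by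
  set f : ℝ → ℝ := fun τ => Real.exp (-x * Real.cosh τ) * Real.exp (ν * τ) with hf
  have hz : 0 < x ^ 2 / 4 := by positivity
  have himg : (fun τ => (x / 2) * Real.exp τ) '' Set.univ = Set.Ioi 0 := by
    ext s; constructor
    · rintro ⟨τ, -, rfl⟩; simp only [Set.mem_Ioi]; positivity
    · intro hs
      have hs' : (0:ℝ) < s := hs
      refine ⟨Real.log (s / (x / 2)), trivial, ?_⟩
      simp only
      rw [Real.exp_log (by positivity)]; field_simp
  have hder : ∀ τ ∈ (Set.univ : Set ℝ), HasDerivWithinAt (fun τ => (x / 2) * Real.exp τ)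
      ((x / 2) * Real.exp τ) Set.univ τ := fun τ _ =>
    ((Real.hasDerivAt_exp τ).const_mul (x / 2)).hasDerivWithinAt
  have hinj : Set.InjOn (fun τ => (x / 2) * Real.exp τ) Set.univ := by
    intro a _ b _ hab
    simp only at hab
    have := mul_left_cancel₀ (by positivity : x / 2 ≠ 0) hab
    exact Real.exp_injective this
  have hpt : ∀ τ, |(x / 2) * Real.exp τ| • jker ν (x ^ 2 / 4) ((x / 2) * Real.exp τ)
      = (x / 2) ^ ν * f τ := by
    intro τ
    have hp : 0 < (x / 2) * Real.exp τ := by positivity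
    rw [abs_of_pos hp, smul_eq_mul, hf]
    unfold jker
    simp only
    rw [Real.rpow_sub_one hp.ne', Real.mul_rpow (by positivity) (by positivity), ← Real.exp_mul,
      Real.cosh_eq]
    have e1 : -(x / 2 * Real.exp τ) - x ^ 2 / 4 / (x / 2 * Real.exp τ)
        = -x * ((Real.exp τ + Real.exp (-τ)) / 2) := by
      rw [Real.exp_neg]; field_simp; ring
    rw [e1, mul_comm τ ν]; field_simp
  have hI1 := integrableOn_image_iff_integrableOn_abs_deriv_smul MeasurableSet.univ hder hinj
    (jker ν (x ^ 2 / 4))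
  have hI2 := integral_image_eq_integral_abs_deriv_smul MeasurableSet.univ hder hinj
    (jker ν (x ^ 2 / 4))
  rw [himg] at hI1 hI2
  simp_rw [hpt] at hI1 hI2
  have hfi : Integrable f := by
    have := hI1.1 (jker_integrable_pos hz)
    rw [integrableOn_univ] at this
    have h2 := this.const_mul ((x / 2) ^ ν)⁻¹
    refine h2.congr (Eventually.of_forall fun τ => ?_)
    have : (x / 2) ^ ν ≠ 0 := by positivity
    simp only; field_simp
  have hjj : jj ν (x ^ 2 / 4) = (x / 2) ^ ν * ∫ τ, f τ := by
    unfold jj; rw [hI2, setIntegral_univ, integral_const_mul]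
  have hK : besselK ν x = (1 / 2) * ∫ τ, f τ := by
    have hsplit := intervalIntegral.integral_Iic_add_Ioi (hfi.integrableOn (s := Set.Iic 0))
      (hfi.integrableOn (s := Set.Ioi 0))
    have hneg := integral_comp_neg_Ioi (0:ℝ) f
    rw [neg_zero] at hneg
    rw [← hsplit, ← hneg, ← integral_add (hfi.comp_neg.integrableOn) hfi.integrableOn,
      ← integral_const_mul]
    unfold besselK
    congr 1; ext t
    simp only [hf]
    rw [Real.cosh_neg, Real.cosh_eq (ν * t)]
    ring_nf
  rw [hK, hjj, Real.rpow_neg (by positivity)]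
  have : (x / 2) ^ ν ≠ 0 := by positivity
  field_simp

noncomputable def gg (μ z : ℝ) : ℝ := ∑' k : ℕ, z ^ k / (Real.Gamma (μ + k + 1) * k.factorial)

lemma gamma_lower {μ : ℝ} (hμ : -(1/2) < μ) (k : ℕ) :
    Real.Gamma (μ + 1) * (1 / 2) ^ k ≤ Real.Gamma (μ + k + 1) := by
  induction k with
  | zero => simp
  | succ k ih =>
    have e : μ + ((k + 1 : ℕ) : ℝ) + 1 = (μ + k + 1) + 1 := by push_cast; ring
    have hk : (0:ℝ) ≤ k := by positivity
    have hne : μ + k + 1 ≠ 0 := by linarith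
    rw [e, Real.Gamma_add_one hne, pow_succ]
    have hG : 0 < Real.Gamma (μ + k + 1) := Real.Gamma_pos_of_pos (by linarith)
    nlinarith

lemma gg_term_le {μ : ℝ} (hμ : -(1/2) < μ) (k : ℕ) {z R : ℝ} (hz : |z| ≤ R) :
    ‖z ^ k / (Real.Gamma (μ + k + 1) * k.factorial)‖ ≤
      (Real.Gamma (μ + 1))⁻¹ * ((2 * R) ^ k / k.factorial) := by
  have hG0 : 0 < Real.Gamma (μ + 1) := Real.Gamma_pos_of_pos (by linarith)
  have hG := gamma_lower hμ k
  have hGk : 0 < Real.Gamma (μ + k + 1) := lt_of_lt_of_le (by positivity) hG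
  rw [norm_div, norm_pow, Real.norm_eq_abs, Real.norm_of_nonneg (by positivity)]
  have hf : (0:ℝ) < k.factorial := by positivity
  calc |z| ^ k / (Real.Gamma (μ + k + 1) * k.factorial)
      ≤ R ^ k / (Real.Gamma (μ + 1) * (1 / 2) ^ k * k.factorial) := by
        have hR : 0 ≤ R := (abs_nonneg z).trans hz
        gcongr
    _ = _ := by rw [mul_pow, div_pow, one_pow]; field_simp

lemma gg_summable_bound (μ R : ℝ) :
    Summable (fun k : ℕ => (Real.Gamma (μ + 1))⁻¹ * ((2 * R) ^ k / k.factorial)) :=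
  (Real.summable_pow_div_factorial _).mul_left _

lemma gg_summable {μ : ℝ} (hμ : -(1/2) < μ) (z : ℝ) :
    Summable (fun k : ℕ => z ^ k / (Real.Gamma (μ + k + 1) * k.factorial)) :=
  Summable.of_norm_bounded (gg_summable_bound μ |z|) (fun k => gg_term_le hμ k le_rfl)

lemma gg_zero (μ : ℝ) : gg μ 0 = (Real.Gamma (μ + 1))⁻¹ := by
  unfold gg
  rw [tsum_eq_single 0]
  · simp
  · intro k hk; simp [hk]

lemma gg_pos {μ : ℝ} (hμ : -(1/2) < μ) {z : ℝ} (hz : 0 ≤ z) : 0 < gg μ z := by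
  unfold gg
  have hnn : ∀ k : ℕ, 0 ≤ z ^ k / (Real.Gamma (μ + k + 1) * k.factorial) := by
    intro k
    have : 0 < Real.Gamma (μ + k + 1) := by
      apply Real.Gamma_pos_of_pos; have : (0:ℝ) ≤ k := by positivity
      linarith
    positivity
  refine (gg_summable hμ z).tsum_pos hnn 0 ?_
  have : 0 < Real.Gamma (μ + 1) := Real.Gamma_pos_of_pos (by linarith)
  simpa using this

lemma gg_hasDerivAt {μ : ℝ} (hμ : -(1/2) < μ) (z : ℝ) : HasDerivAt (gg μ) (gg (μ + 1) z) z := by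
  set g : ℕ → ℝ → ℝ := fun k z => z ^ k / (Real.Gamma (μ + k + 1) * k.factorial) with hg
  set g' : ℕ → ℝ → ℝ := fun k z => (k * z ^ (k - 1)) / (Real.Gamma (μ + k + 1) * k.factorial) with hg'
  have hsucc : ∀ k y, g' (k + 1) y = y ^ k / (Real.Gamma (μ + 1 + k + 1) * k.factorial) := by
    intro k y
    have hG : Real.Gamma (μ + 1 + k + 1) ≠ 0 := by
      apply (Real.Gamma_pos_of_pos _).ne'
      have : (0:ℝ) ≤ k := by positivity
      linarith
    simp only [hg', Nat.add_sub_cancel, Nat.factorial_succ]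
    push_cast
    rw [show μ + ((k:ℝ) + 1) + 1 = μ + 1 + k + 1 by ring]
    field_simp
  set u : ℕ → ℝ := fun k => ‖g' k (|z| + 1)‖ with hu
  have hus : Summable u := by
    rw [← summable_nat_add_iff 1]
    simp only [hu, hsucc]
    exact (gg_summable (μ := μ + 1) (by linarith) (|z| + 1)).norm
  have key := hasDerivAt_tsum_of_isPreconnected (g := g) (g' := g') (u := u)
    (t := Metric.ball 0 (|z| + 1)) (y := z) (y₀ := z) hus Metric.isOpen_ball
    (convex_ball _ _).isPreconnected ?_ ?_ (by simp) (gg_summable hμ z) (by simp)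
  · refine key.congr_deriv ?_
    have hs : Summable (fun k => g' k z) := by
      rw [← summable_nat_add_iff 1]
      simp only [hsucc]
      exact (gg_summable (μ := μ + 1) (by linarith) z)
    rw [hs.tsum_eq_zero_add]
    simp only [hsucc]
    simp [hg', gg]
  · intro k y _
    exact (hasDerivAt_pow k y).div_const _
  · intro k y hy
    simp only [hu, hg', norm_div, norm_mul, norm_pow, Real.norm_eq_abs]
    rw [mem_ball_zero_iff, Real.norm_eq_abs] at hy
    have : |(|z| + 1)| = |z| + 1 := abs_of_nonneg (by positivity)
    rw [this]
    gcongr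

lemma gg_rec {μ : ℝ} (hμ : -(1/2) < μ) (z : ℝ) :
    gg μ z = (μ + 1) * gg (μ + 1) z + z * gg (μ + 2) z := by
  have s0 := gg_summable hμ z
  have s1 := gg_summable (μ := μ + 1) (by linarith) z
  have s2 := gg_summable (μ := μ + 2) (by linarith) z
  unfold gg
  rw [← tsum_mul_left, ← tsum_mul_left, s0.tsum_eq_zero_add, (s1.mul_left (μ + 1)).tsum_eq_zero_add,
    add_assoc ((μ + 1) * _), ← Summable.tsum_add]
  · congr 1
    · have hG : Real.Gamma (μ + 1) ≠ 0 := (Real.Gamma_pos_of_pos (by linarith)).ne'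
      simp only [pow_zero, CharP.cast_eq_zero, add_zero, Nat.factorial_zero, Nat.cast_one, mul_one]
      rw [Real.Gamma_add_one (by linarith : μ + 1 ≠ 0)]
      have : μ + 1 ≠ 0 := by linarith
      field_simp
    · congr 1; ext k
      have hk : (0:ℝ) ≤ k := by positivity
      have hG : Real.Gamma (μ + k + 2) ≠ 0 := (Real.Gamma_pos_of_pos (by linarith)).ne'
      have hne : μ + k + 2 ≠ 0 := by linarith
      push_cast [Nat.factorial_succ]
      rw [show μ + ((k:ℝ) + 1) + 1 = μ + k + 2 by ring,
        show μ + 1 + ((k:ℝ) + 1) + 1 = (μ + k + 2) + 1 by ring,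
        show μ + 2 + (k:ℝ) + 1 = (μ + k + 2) + 1 by ring, Real.Gamma_add_one hne]
      field_simp
      ring
  · exact (summable_nat_add_iff 1).2 (s1.mul_left (μ + 1))
  · exact s2.mul_left z

lemma besselI_eq (ν : ℝ) {x : ℝ} (hx : 0 < x) :
    besselI ν x = (x / 2) ^ ν * gg ν (x ^ 2 / 4) := by
  unfold besselI gg
  rw [← tsum_mul_left]
  congr 1; ext k
  have e : (x / 2) ^ (ν + 2 * (k:ℝ)) = (x / 2) ^ ν * (x ^ 2 / 4) ^ k := by
    rw [Real.rpow_add (by positivity), Real.rpow_mul (by positivity), Real.rpow_natCast]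
    congr 2
    rw [show (2:ℝ) = ((2:ℕ):ℝ) by norm_num, Real.rpow_natCast]; ring
  rw [e]; ring

lemma gauss_lin (β : ℝ) {b : ℝ} (hb : 0 < b) :
    Integrable (fun t : ℝ => Real.exp (β * t - b * t ^ 2)) ∧
    ∫ t : ℝ, Real.exp (β * t - b * t ^ 2) = Real.sqrt (Real.pi / b) * Real.exp (β ^ 2 / (4 * b)) := by
  have e : (fun t : ℝ => Real.exp (β * t - b * t ^ 2)) =
      fun t => Real.exp (-b * (t - β / (2 * b)) ^ 2) * Real.exp (β ^ 2 / (4 * b)) := by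
    ext t; rw [← Real.exp_add]; congr 1; field_simp; ring
  rw [e]
  constructor
  · exact ((integrable_exp_neg_mul_sq hb).comp_sub_right _).mul_const _
  · rw [integral_mul_const, integral_sub_right_eq_self (fun t : ℝ => Real.exp (-b * t ^ 2)),
      integral_gaussian]

lemma mass {ν α β : ℝ} (hν : -(1/2) < ν) (hα : 0 < α) (hβ : β ^ 2 < α ^ 2) :
    Integrable (fun t : ℝ => Real.exp (β * t) * jj ν (α ^ 2 * t ^ 2 / 4)) ∧
    ∫ t : ℝ, Real.exp (β * t) * jj ν (α ^ 2 * t ^ 2 / 4) =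
      2 * Real.sqrt Real.pi / α * Real.Gamma (ν + 1/2) * (α ^ 2 / (α ^ 2 - β ^ 2)) ^ (ν + 1/2) := by
  set F : ℝ → ℝ → ℝ := fun t s => Real.exp (β * t) * jker ν (α ^ 2 * t ^ 2 / 4) s with hF
  have hmeas : Measurable (Function.uncurry F) := by
    simp only [hF, Function.uncurry_def, jker]; fun_prop
  set c := (α ^ 2 - β ^ 2) / α ^ 2 with hc
  have hcpos : 0 < c := by rw [hc]; apply div_pos (by linarith) (by positivity)
  have hFs : ∀ s, (F · s) = fun t => (s ^ (ν - 1) * Real.exp (-s)) *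
      Real.exp (β * t - (α ^ 2 / (4 * s)) * t ^ 2) := by
    intro s; ext t
    simp only [hF, jker]
    rw [show β * t - (α ^ 2 / (4 * s)) * t ^ 2 = β * t + -(α ^ 2 * t ^ 2 / 4 / s) by
      rcases eq_or_ne s 0 with rfl | hs
      · simp
      · field_simp; ring, Real.exp_add, sub_eq_add_neg (-s), Real.exp_add]
    ring
  have hint : ∀ s ∈ Set.Ioi (0:ℝ), ∫ t, F t s =
      (2 * Real.sqrt Real.pi / α) * (s ^ (ν + 1/2 - 1) * Real.exp (-(c * s))) := by
    intro s hs
    have hs' : (0:ℝ) < s := hs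
    have : (∫ t, F t s) = ∫ t, (F · s) t := rfl
    rw [this, hFs, integral_const_mul, (gauss_lin β (by positivity)).2]
    have e1 : Real.sqrt (Real.pi / (α ^ 2 / (4 * s))) = 2 * Real.sqrt Real.pi / α * Real.sqrt s := by
      rw [show Real.pi / (α ^ 2 / (4 * s)) = (2 / α) ^ 2 * (Real.pi * s) by field_simp; ring,
        Real.sqrt_mul (by positivity), Real.sqrt_sq (by positivity), Real.sqrt_mul (by positivity)]
      ring
    have e2 : s ^ (ν + 1/2 - 1) = s ^ (ν - 1) * Real.sqrt s := by
      rw [Real.sqrt_eq_rpow, ← Real.rpow_add hs']; ring_nf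
    have e3 : Real.exp (-(c * s)) = Real.exp (-s) * Real.exp (β ^ 2 / (4 * (α ^ 2 / (4 * s)))) := by
      rw [← Real.exp_add]; congr 1; rw [hc]; field_simp; ring
    rw [e1, e2, e3]; ring
  have hgi : IntegrableOn (fun s : ℝ => s ^ (ν + 1/2 - 1) * Real.exp (-(c * s))) (Set.Ioi 0) := by
    have := integrableOn_rpow_mul_exp_neg_mul_rpow (p := 1) (s := ν + 1/2 - 1) (b := c)
      (by linarith) (by norm_num) hcpos
    simpa using this
  have hFi : Integrable (Function.uncurry F) (volume.prod (volume.restrict (Set.Ioi (0:ℝ)))) := by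
    rw [integrable_prod_iff' hmeas.aestronglyMeasurable]
    constructor
    · filter_upwards [self_mem_ae_restrict measurableSet_Ioi] with s hs
      have hs' : (0:ℝ) < s := hs
      have := (gauss_lin β (b := α ^ 2 / (4 * s)) (by positivity)).1.const_mul
        (s ^ (ν - 1) * Real.exp (-s))
      rw [← hFs] at this
      exact this
    · refine (hgi.const_mul (2 * Real.sqrt Real.pi / α)).congr ?_
      filter_upwards [self_mem_ae_restrict measurableSet_Ioi] with s hs
      rw [← hint s hs]
      congr 1; ext t
      simp only [Function.uncurry]
      rw [Real.norm_of_nonneg]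
      exact mul_nonneg (Real.exp_pos _).le (jker_pos _ _ hs).le
  have hinner : (fun t => ∫ s in Set.Ioi (0:ℝ), F t s) =
      fun t : ℝ => Real.exp (β * t) * jj ν (α ^ 2 * t ^ 2 / 4) := by
    ext t; simp only [hF, jj]; rw [integral_const_mul]
  constructor
  · rw [← hinner]; exact hFi.integral_prod_left
  · rw [← hinner, integral_integral_swap hFi, setIntegral_congr_fun measurableSet_Ioi hint,
      integral_const_mul, Real.integral_rpow_mul_exp_neg_mul_Ioi (by linarith) hcpos, hc, one_div_div]
    ring


noncomputable def pp (ν α β x : ℝ) : ℝ := Real.exp (β * x) * jj ν (α ^ 2 * x ^ 2 / 4)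
noncomputable def qq (ν α β x : ℝ) : ℝ := Real.exp (β * x) * x ^ (2 * ν) * gg ν (α ^ 2 * x ^ 2 / 4)
noncomputable def PP (ν α β x : ℝ) : ℝ :=
  Real.exp (β * x) * (2 * jj (ν + 1) (α ^ 2 * x ^ 2 / 4) + β * x * jj ν (α ^ 2 * x ^ 2 / 4))
noncomputable def QQ (ν α β x : ℝ) : ℝ :=
  Real.exp (β * x) * x ^ (2 * ν + 1) *
    (α ^ 2 * x / 2 * gg (ν + 1) (α ^ 2 * x ^ 2 / 4) - β * gg ν (α ^ 2 * x ^ 2 / 4))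
noncomputable def ww (ν α β x : ℝ) : ℝ := (α ^ 2 - β ^ 2) * x - (2 * ν + 1) * β
noncomputable def AA (ν α β x : ℝ) : ℝ :=
  Real.exp (-(β * x)) * x ^ (-(2 * ν)) * jj ν (α ^ 2 * x ^ 2 / 4)
noncomputable def BB (ν α β x : ℝ) : ℝ := Real.exp (-(β * x)) * gg ν (α ^ 2 * x ^ 2 / 4)

lemma jx_deriv (μ : ℝ) {α x : ℝ} (hα : 0 < α) (hx : 0 < x) :
    HasDerivAt (fun x => jj μ (α ^ 2 * x ^ 2 / 4))
      (-jj (μ - 1) (α ^ 2 * x ^ 2 / 4) * (α ^ 2 * x / 2)) x := by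
  have h1 : HasDerivAt (fun x : ℝ => α ^ 2 * x ^ 2 / 4) (α ^ 2 * x / 2) x := by
    refine (((hasDerivAt_pow 2 x).const_mul (α ^ 2)).div_const 4).congr_deriv ?_
    norm_num; ring
  exact (jj_hasDerivAt μ (z := α ^ 2 * x ^ 2 / 4) (by positivity)).comp x h1

lemma gx_deriv {μ : ℝ} (hμ : -(1/2) < μ) (α x : ℝ) :
    HasDerivAt (fun x => gg μ (α ^ 2 * x ^ 2 / 4))
      (gg (μ + 1) (α ^ 2 * x ^ 2 / 4) * (α ^ 2 * x / 2)) x := by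
  have h1 : HasDerivAt (fun x : ℝ => α ^ 2 * x ^ 2 / 4) (α ^ 2 * x / 2) x := by
    refine (((hasDerivAt_pow 2 x).const_mul (α ^ 2)).div_const 4).congr_deriv ?_
    norm_num; ring
  exact (gg_hasDerivAt hμ (α ^ 2 * x ^ 2 / 4)).comp x h1

lemma exp_deriv (β x : ℝ) : HasDerivAt (fun x : ℝ => Real.exp (β * x)) (Real.exp (β * x) * β) x := by
  simpa using ((hasDerivAt_id x).const_mul β).exp

lemma expn_deriv (β x : ℝ) :
    HasDerivAt (fun x : ℝ => Real.exp (-(β * x))) (-(Real.exp (-(β * x)) * β)) x := by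
  simpa using ((hasDerivAt_id x).const_mul β).neg.exp

lemma PP_deriv (ν : ℝ) {α x : ℝ} (β : ℝ) (hα : 0 < α) (hx : 0 < x) :
    HasDerivAt (PP ν α β) (-(ww ν α β x * pp ν α β x)) x := by
  have hr := jj_rec ν (z := α ^ 2 * x ^ 2 / 4) (by positivity)
  have h := (exp_deriv β x).mul (((jx_deriv (ν + 1) hα hx).const_mul 2).add
    (((hasDerivAt_id x).const_mul β).mul (jx_deriv ν hα hx)))
  refine h.congr_deriv ?_
  simp only [Pi.add_apply, Pi.mul_apply, id, add_sub_cancel_right, ww, pp]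
  linear_combination 2 * β * Real.exp (β * x) * hr

lemma pp_deriv (ν : ℝ) {α x : ℝ} (β : ℝ) (hα : 0 < α) (hx : 0 < x) :
    HasDerivAt (pp ν α β) (Real.exp (β * x) * β * jj ν (α ^ 2 * x ^ 2 / 4) +
      Real.exp (β * x) * (-jj (ν - 1) (α ^ 2 * x ^ 2 / 4) * (α ^ 2 * x / 2))) x :=
  (exp_deriv β x).mul (jx_deriv ν hα hx)

lemma xpp_deriv (ν : ℝ) {α x : ℝ} (β : ℝ) (hα : 0 < α) (hx : 0 < x) :
    HasDerivAt (fun x => x * pp ν α β x)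
      ((2 * ν + 1 + 2 * β * x) * pp ν α β x - PP ν α β x) x := by
  have hr := jj_rec ν (z := α ^ 2 * x ^ 2 / 4) (by positivity)
  have h := (hasDerivAt_id x).mul (pp_deriv ν β hα hx)
  refine h.congr_deriv ?_
  simp only [id, PP, pp]
  linear_combination 2 * Real.exp (β * x) * hr

lemma QQ_deriv {ν α x : ℝ} (β : ℝ) (hν : -(1/2) < ν) (hx : 0 < x) :
    HasDerivAt (QQ ν α β) (ww ν α β x * qq ν α β x) x := by
  have hr := gg_rec hν (α ^ 2 * x ^ 2 / 4)
  have hp : HasDerivAt (fun x : ℝ => x ^ (2 * ν + 1)) ((2 * ν + 1) * x ^ (2 * ν)) x := by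
    have := Real.hasDerivAt_rpow_const (x := x) (p := 2 * ν + 1) (Or.inl hx.ne')
    simpa using this
  have hg1 := gx_deriv (μ := ν + 1) (by linarith) α x
  rw [add_assoc, one_add_one_eq_two] at hg1
  have hl : HasDerivAt (fun x : ℝ => α ^ 2 * x / 2) (α ^ 2 / 2) x := by
    simpa using ((hasDerivAt_id x).const_mul (α ^ 2)).div_const 2
  have h := ((exp_deriv β x).mul hp).mul ((hl.mul hg1).sub ((gx_deriv hν α x).const_mul β))
  refine h.congr_deriv ?_
  simp only [Pi.sub_apply, Pi.mul_apply, ww, qq]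
  rw [Real.rpow_add_one hx.ne']
  linear_combination -(Real.exp (β * x) * x ^ (2 * ν) * x * α ^ 2) * hr

lemma AA_deriv (ν : ℝ) {α x : ℝ} (β : ℝ) (hα : 0 < α) (hx : 0 < x) :
    HasDerivAt (AA ν α β)
      (-(x ^ (-(2 * ν) - 1) * Real.exp (-(β * x)) * Real.exp (-(β * x)) * PP ν α β x)) x := by
  have hr := jj_rec ν (z := α ^ 2 * x ^ 2 / 4) (by positivity)
  have hp : HasDerivAt (fun x : ℝ => x ^ (-(2 * ν))) (-(2 * ν) * x ^ (-(2 * ν) - 1)) x :=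
    Real.hasDerivAt_rpow_const (Or.inl hx.ne')
  have h := ((expn_deriv β x).mul hp).mul (jx_deriv ν hα hx)
  refine h.congr_deriv ?_
  have e : x ^ (-(2 * ν)) = x ^ (-(2 * ν) - 1) * x := by
    rw [Real.rpow_sub_one hx.ne']; field_simp
  have e2 : Real.exp (-(β * x)) * Real.exp (β * x) = 1 := by rw [← Real.exp_add]; simp
  simp only [Pi.mul_apply, PP]
  rw [e]
  linear_combination (2 * x ^ (-(2 * ν) - 1) * Real.exp (-(β * x))) * hr +
    (x ^ (-(2 * ν) - 1) * Real.exp (-(β * x))) *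
    (2 * jj (ν + 1) (α ^ 2 * x ^ 2 / 4) + β * x * jj ν (α ^ 2 * x ^ 2 / 4)) * e2

lemma BB_deriv {ν α x : ℝ} (β : ℝ) (hν : -(1/2) < ν) (hx : 0 < x) :
    HasDerivAt (BB ν α β)
      (x ^ (-(2 * ν) - 1) * Real.exp (-(β * x)) * Real.exp (-(β * x)) * QQ ν α β x) x := by
  have h := (expn_deriv β x).mul (gx_deriv hν α x)
  refine h.congr_deriv ?_
  have e : x ^ (-(2 * ν) - 1) * x ^ (2 * ν + 1) = 1 := by
    rw [← Real.rpow_add hx]; simp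
  have e2 : Real.exp (-(β * x)) * Real.exp (β * x) = 1 := by rw [← Real.exp_add]; simp
  simp only [QQ]
  generalize x ^ (-(2 * ν) - 1) = u at *
  generalize x ^ (2 * ν + 1) = v at *
  generalize Real.exp (-(β * x)) = E at *
  generalize Real.exp (β * x) = E' at *
  generalize gg ν (α ^ 2 * x ^ 2 / 4) = g at *
  generalize gg (ν + 1) (α ^ 2 * x ^ 2 / 4) = g1 at *
  linear_combination (-E * E * E' * (α ^ 2 * x / 2 * g1 - β * g)) * e +
    (-E * (α ^ 2 * x / 2 * g1 - β * g)) * e2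

lemma AAqq {ν α x : ℝ} (β : ℝ) (hx : 0 < x) :
    AA ν α β x * qq ν α β x = jj ν (α ^ 2 * x ^ 2 / 4) * gg ν (α ^ 2 * x ^ 2 / 4) := by
  have e : x ^ (-(2 * ν)) * x ^ (2 * ν) = 1 := by
    rw [← Real.rpow_add hx]; simp
  have e2 : Real.exp (-(β * x)) * Real.exp (β * x) = 1 := by rw [← Real.exp_add]; simp
  simp only [AA, qq]
  calc _ = (x ^ (-(2 * ν)) * x ^ (2 * ν)) * (Real.exp (-(β * x)) * Real.exp (β * x)) *
    (jj ν (α ^ 2 * x ^ 2 / 4) * gg ν (α ^ 2 * x ^ 2 / 4)) := by ring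
    _ = _ := by rw [e, e2]; ring

lemma BBpp (ν α β x : ℝ) :
    BB ν α β x * pp ν α β x = jj ν (α ^ 2 * x ^ 2 / 4) * gg ν (α ^ 2 * x ^ 2 / 4) := by
  have e2 : Real.exp (-(β * x)) * Real.exp (β * x) = 1 := by rw [← Real.exp_add]; simp
  simp only [BB, pp]
  calc _ = (Real.exp (-(β * x)) * Real.exp (β * x)) *
    (jj ν (α ^ 2 * x ^ 2 / 4) * gg ν (α ^ 2 * x ^ 2 / 4)) := by ring
    _ = _ := by rw [e2]; ring

lemma wronskian {ν z : ℝ} (hν : -(1/2) < ν) (hz : 0 < z) :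
    z * jj ν z * gg (ν + 1) z + gg ν z * jj (ν + 1) z = 1 := by
  set W : ℝ → ℝ := fun z => z * jj ν z * gg (ν + 1) z + gg ν z * jj (ν + 1) z with hW
  have hd : ∀ y ∈ Set.Ioi (0:ℝ), HasDerivAt W 0 y := by
    intro y hy
    have hy' : (0:ℝ) < y := hy
    have h1 := gg_hasDerivAt (μ := ν + 1) (by linarith) y
    rw [add_assoc, one_add_one_eq_two] at h1
    have hj := jj_hasDerivAt (ν + 1) hy'
    rw [add_sub_cancel_right] at hj
    have h := ((((hasDerivAt_id y).mul (jj_hasDerivAt ν hy')).mul h1)).add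
      ((gg_hasDerivAt hν y).mul hj)
    refine h.congr_deriv ?_
    simp only [Pi.mul_apply, id]
    have r1 := jj_rec ν hy'
    have r2 := gg_rec hν y
    linear_combination gg (ν + 1) y * r1 - jj ν y * r2
  have hlim : Tendsto W (nhdsWithin 0 (Set.Ioi 0)) (nhds 1) := by
    have hg1 : Tendsto (gg (ν + 1)) (nhdsWithin 0 (Set.Ioi 0)) (nhds (gg (ν + 1) 0)) :=
      (gg_hasDerivAt (by linarith) 0).continuousAt.tendsto.mono_left nhdsWithin_le_nhds
    have hg0 : Tendsto (gg ν) (nhdsWithin 0 (Set.Ioi 0)) (nhds (gg ν 0)) :=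
      (gg_hasDerivAt hν 0).continuousAt.tendsto.mono_left nhdsWithin_le_nhds
    have hj1 := jj_tendsto (μ := ν + 1) (by linarith)
    have hz0 : Tendsto (fun z : ℝ => z * jj ν z) (nhdsWithin 0 (Set.Ioi 0)) (nhds 0) := by
      have h1 := sqrt_jj_tendsto hν
      have h2 : Tendsto (fun z : ℝ => Real.sqrt z) (nhdsWithin 0 (Set.Ioi 0)) (nhds 0) := by
        have := Real.continuous_sqrt.tendsto 0
        rw [Real.sqrt_zero] at this
        exact this.mono_left nhdsWithin_le_nhds
      have h3 := h2.mul h1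
      rw [mul_zero] at h3
      refine h3.congr' ?_
      filter_upwards [self_mem_nhdsWithin] with y hy
      rw [← mul_assoc, Real.mul_self_sqrt (le_of_lt hy)]
    have := (hz0.mul hg1).add (hg0.mul hj1)
    rw [gg_zero ν, zero_mul, zero_add, inv_mul_cancel₀] at this
    · exact this
    · exact (Real.Gamma_pos_of_pos (by linarith)).ne'
  have hconst : ∀ y ∈ Set.Ioi (0:ℝ), W y = W z := by
    intro y hy
    refine (convex_Ioi (0:ℝ)).is_const_of_fderivWithin_eq_zero (𝕜 := ℝ) (f := W)
      (fun t ht => (hd t ht).differentiableAt.differentiableWithinAt) ?_ hy hz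
    intro t ht
    rw [fderivWithin_of_isOpen isOpen_Ioi ht]
    have := (hd t ht).hasFDerivAt.fderiv
    rw [this]; ext; simp
  have : Tendsto W (nhdsWithin 0 (Set.Ioi 0)) (nhds (W z)) := by
    refine tendsto_const_nhds.congr' ?_
    filter_upwards [self_mem_nhdsWithin] with y hy
    exact (hconst y hy).symm
  exact tendsto_nhds_unique this hlim

lemma AQBP {ν α x : ℝ} (β : ℝ) (hν : -(1/2) < ν) (hα : 0 < α) (hx : 0 < x) :
    AA ν α β x * QQ ν α β x + BB ν α β x * PP ν α β x = 2 := by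
  have hw := wronskian hν (z := α ^ 2 * x ^ 2 / 4) (by positivity)
  have e : x ^ (-(2 * ν)) * x ^ (2 * ν + 1) = x := by
    rw [← Real.rpow_add hx]; simp
  have e2 : Real.exp (-(β * x)) * Real.exp (β * x) = 1 := by rw [← Real.exp_add]; simp
  simp only [AA, QQ, BB, PP]
  calc _ = (Real.exp (-(β * x)) * Real.exp (β * x)) *
      ((x ^ (-(2 * ν)) * x ^ (2 * ν + 1)) * jj ν (α ^ 2 * x ^ 2 / 4) *
      (α ^ 2 * x / 2 * gg (ν + 1) (α ^ 2 * x ^ 2 / 4) - β * gg ν (α ^ 2 * x ^ 2 / 4)) +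
      gg ν (α ^ 2 * x ^ 2 / 4) *
      (2 * jj (ν + 1) (α ^ 2 * x ^ 2 / 4) + β * x * jj ν (α ^ 2 * x ^ 2 / 4))) := by ring
    _ = 2 := by
      rw [e, e2]
      linear_combination 2 * hw


lemma jj_nonneg (μ z : ℝ) : 0 ≤ jj μ z :=
  setIntegral_nonneg measurableSet_Ioi fun _ hs => (jker_pos μ z hs).le

lemma pp_nonneg (ν α β x : ℝ) : 0 ≤ pp ν α β x := mul_nonneg (Real.exp_pos _).le (jj_nonneg _ _)

lemma pp_neg (ν α β x : ℝ) : pp ν α β (-x) = pp ν α (-β) x := by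
  unfold pp; congr 2 <;> ring_nf

lemma pp_integrable {ν α β : ℝ} (hν : -(1/2) < ν) (hα : 0 < α) (hβ : β ^ 2 < α ^ 2) :
    Integrable (pp ν α β) := (mass hν hα hβ).1

lemma tpp_integrable {ν α β : ℝ} (hν : -(1/2) < ν) (hα : 0 < α) (hβ : β ^ 2 < α ^ 2) (n : ℕ) :
    Integrable (fun t => t ^ n * pp ν α β t) := by
  have hβ' : |β| < α := by
    rw [← sq_abs] at hβ
    exact lt_of_pow_lt_pow_left₀ 2 hα.le hβ
  obtain ⟨δ, hδ, hδ2⟩ : ∃ δ, 0 < δ ∧ |β| + δ < α := ⟨(α - |β|) / 2, by linarith, by linarith⟩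
  have hb : ∀ γ, |γ| = δ → (β + γ) ^ 2 < α ^ 2 := by
    intro γ hγ
    rw [sq_lt_sq, abs_of_pos hα]
    exact lt_of_le_of_lt (abs_add_le _ _) (by rw [hγ]; exact hδ2)
  have i1 := pp_integrable hν hα (hb δ (abs_of_pos hδ))
  have i2 := pp_integrable hν hα (hb (-δ) (by rw [abs_neg, abs_of_pos hδ]))
  have hi := (i1.add i2).const_mul (n.factorial / δ ^ n)
  refine Integrable.mono' hi ?_ ?_
  · exact (by fun_prop : Continuous fun t : ℝ => t ^ n).aestronglyMeasurable.mul
      (pp_integrable hν hα hβ).aestronglyMeasurable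
  · refine Eventually.of_forall fun t => ?_
    rw [norm_mul, norm_pow, Real.norm_eq_abs, Real.norm_of_nonneg (pp_nonneg _ _ _ _)]
    have h1 := Real.pow_div_factorial_le_exp (x := δ * |t|) (by positivity) n
    have h2 : Real.exp (δ * |t|) ≤ Real.exp (δ * t) + Real.exp (-δ * t) := by
      rcases abs_cases t with ⟨h, _⟩ | ⟨h, _⟩ <;> rw [h]
      · linarith [Real.exp_pos (-δ * t)]
      · have := Real.exp_pos (δ * t)
        rw [show δ * -t = -δ * t by ring]; linarith
    have h3 : |t| ^ n ≤ n.factorial / δ ^ n * (Real.exp (δ * t) + Real.exp (-δ * t)) := by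
      have h4 := h1.trans h2
      rw [mul_pow] at h4
      have hf : (0:ℝ) < n.factorial := by positivity
      rw [div_le_iff₀ hf] at h4
      rw [div_mul_eq_mul_div, le_div_iff₀ (by positivity)]
      nlinarith
    have e1 : (pp ν α (β + δ) + pp ν α (β + -δ)) t =
        (Real.exp (δ * t) + Real.exp (-δ * t)) * pp ν α β t := by
      simp only [Pi.add_apply, pp]
      rw [add_mul β, add_mul β, Real.exp_add, Real.exp_add]; ring
    simp only [e1]
    rw [← mul_assoc]
    exact mul_le_mul_of_nonneg_right h3 (pp_nonneg _ _ _ _)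

lemma PP_eq (ν α β x : ℝ) :
    PP ν α β x = 2 * pp (ν + 1) α β x + β * (x ^ 1 * pp ν α β x) := by
  unfold PP pp; ring

lemma tPP_integrable {ν α β : ℝ} (hν : -(1/2) < ν) (hα : 0 < α) (hβ : β ^ 2 < α ^ 2) (n : ℕ) :
    Integrable (fun t => t ^ n * PP ν α β t) := by
  have h1 := (tpp_integrable (ν := ν + 1) (by linarith) hα hβ n).const_mul 2
  have h2 := (tpp_integrable hν hα hβ (n + 1)).const_mul β
  refine (h1.add h2).congr (Eventually.of_forall fun t => ?_)
  simp only [Pi.add_apply, PP_eq]; ring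

lemma wpp_integrable {ν α β : ℝ} (hν : -(1/2) < ν) (hα : 0 < α) (hβ : β ^ 2 < α ^ 2) :
    Integrable (fun t => ww ν α β t * pp ν α β t) := by
  have h1 := (tpp_integrable hν hα hβ 1).const_mul (α ^ 2 - β ^ 2)
  have h2 := (pp_integrable hν hα hβ).const_mul ((2 * ν + 1) * β)
  refine (h1.sub h2).congr (Eventually.of_forall fun t => ?_)
  simp only [Pi.sub_apply, ww]; ring

lemma PP_tendsto_atTop {ν α β : ℝ} (hν : -(1/2) < ν) (hα : 0 < α) (hβ : β ^ 2 < α ^ 2) :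
    Tendsto (PP ν α β) atTop (nhds 0) := by
  refine tendsto_zero_of_hasDerivAt_of_integrableOn_Ioi (a := 0)
    (fun x hx => PP_deriv ν β hα hx) (wpp_integrable hν hα hβ).neg.integrableOn ?_
  have := tPP_integrable hν hα hβ 0
  simp only [pow_zero, one_mul] at this
  exact this.integrableOn

lemma int_wpp {ν α β x : ℝ} (hν : -(1/2) < ν) (hα : 0 < α) (hβ : β ^ 2 < α ^ 2) (hx : 0 < x) :
    ∫ t in Set.Ioi x, ww ν α β t * pp ν α β t = PP ν α β x := by
  have := integral_Ioi_of_hasDerivAt_of_tendsto' (a := x) (f := PP ν α β)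
    (fun t ht => PP_deriv ν β hα (lt_of_lt_of_le hx ht))
    (wpp_integrable hν hα hβ).neg.integrableOn (PP_tendsto_atTop hν hα hβ)
  rw [integral_neg] at this
  linarith

lemma zx_tendsto {α : ℝ} (hα : 0 < α) :
    Tendsto (fun x : ℝ => α ^ 2 * x ^ 2 / 4) (nhdsWithin 0 (Set.Ioi 0)) (nhdsWithin 0 (Set.Ioi 0)) := by
  refine tendsto_nhdsWithin_iff.2 ⟨?_, ?_⟩
  · have : Continuous (fun x : ℝ => α ^ 2 * x ^ 2 / 4) := by fun_prop
    have h := this.tendsto 0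
    simp only [ne_eq, OfNat.ofNat_ne_zero, not_false_eq_true, zero_pow, mul_zero, zero_div] at h
    exact h.mono_left nhdsWithin_le_nhds
  · filter_upwards [self_mem_nhdsWithin] with x hx
    have : (0:ℝ) < x := hx
    simp only [Set.mem_Ioi]; positivity

lemma xjj_tendsto {ν α : ℝ} (hν : -(1/2) < ν) (hα : 0 < α) :
    Tendsto (fun x : ℝ => x * jj ν (α ^ 2 * x ^ 2 / 4)) (nhdsWithin 0 (Set.Ioi 0)) (nhds 0) := by
  have h := ((sqrt_jj_tendsto hν).comp (zx_tendsto hα)).const_mul (2 / α)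
  rw [mul_zero] at h
  refine h.congr' ?_
  filter_upwards [self_mem_nhdsWithin] with x hx
  have hx' : (0:ℝ) < x := hx
  simp only [Function.comp]
  rw [show α ^ 2 * x ^ 2 / 4 = (α * x / 2) ^ 2 by ring, Real.sqrt_sq (by positivity)]
  field_simp

lemma exp_tendsto0 (β : ℝ) :
    Tendsto (fun x : ℝ => Real.exp (β * x)) (nhdsWithin 0 (Set.Ioi 0)) (nhds 1) := by
  have : Continuous (fun x : ℝ => Real.exp (β * x)) := by fun_prop
  have h := this.tendsto 0
  simp only [mul_zero, Real.exp_zero] at h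
  exact h.mono_left nhdsWithin_le_nhds

lemma id_tendsto0 : Tendsto (fun x : ℝ => x) (nhdsWithin 0 (Set.Ioi 0)) (nhds 0) :=
  tendsto_id.mono_left nhdsWithin_le_nhds

lemma xpp_tendsto {ν α : ℝ} (β : ℝ) (hν : -(1/2) < ν) (hα : 0 < α) :
    Tendsto (fun x : ℝ => x * pp ν α β x) (nhdsWithin 0 (Set.Ioi 0)) (nhds 0) := by
  have := (exp_tendsto0 β).mul (xjj_tendsto hν hα)
  rw [mul_zero] at this
  refine this.congr fun x => ?_
  unfold pp; ring

lemma PP_tendsto {ν α : ℝ} (β : ℝ) (hν : -(1/2) < ν) (hα : 0 < α) :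
    Tendsto (PP ν α β) (nhdsWithin 0 (Set.Ioi 0)) (nhds (2 * Real.Gamma (ν + 1))) := by
  have h1 := (jj_tendsto (μ := ν + 1) (by linarith)).comp (zx_tendsto hα)
  have h := (exp_tendsto0 β).mul ((h1.const_mul 2).add ((xjj_tendsto hν hα).const_mul β))
  rw [one_mul, mul_zero, add_zero] at h
  refine h.congr fun x => ?_
  simp only [PP, Function.comp]; ring

lemma int_wpp0 {ν α β : ℝ} (hν : -(1/2) < ν) (hα : 0 < α) (hβ : β ^ 2 < α ^ 2) :
    ∫ t in Set.Ioi (0:ℝ), ww ν α β t * pp ν α β t = 2 * Real.Gamma (ν + 1) := by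
  have hP := tPP_integrable hν hα hβ 0
  simp only [pow_zero, one_mul] at hP
  have := int_Ioi_lim (fun x hx => PP_deriv ν β hα hx) (wpp_integrable hν hα hβ).neg.integrableOn
    hP.integrableOn (PP_tendsto β hν hα)
  rw [integral_neg] at this
  linarith

lemma int_sq0 {ν α β : ℝ} (hν : -(1/2) < ν) (hα : 0 < α) (hβ : β ^ 2 < α ^ 2) :
    ∫ t in Set.Ioi (0:ℝ), ((α ^ 2 - β ^ 2) * (t ^ 2 * pp ν α β t) -
      (2 * ν + 3) * β * (t ^ 1 * pp ν α β t) - (2 * ν + 1) * (t ^ 0 * pp ν α β t)) = 0 := by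
  have i0 := tpp_integrable hν hα hβ 0
  have i1 := tpp_integrable hν hα hβ 1
  have i2 := tpp_integrable hν hα hβ 2
  have iI := ((i2.const_mul (α ^ 2 - β ^ 2)).sub (i1.const_mul ((2 * ν + 3) * β))).sub
    (i0.const_mul (2 * ν + 1))
  have hd : ∀ x ∈ Set.Ioi (0:ℝ), HasDerivAt (fun x => x * pp ν α β x + x * PP ν α β x)
      (-((α ^ 2 - β ^ 2) * (x ^ 2 * pp ν α β x) -
      (2 * ν + 3) * β * (x ^ 1 * pp ν α β x) - (2 * ν + 1) * (x ^ 0 * pp ν α β x))) x := by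
    intro x hx
    have h := (xpp_deriv ν β hα hx).add ((hasDerivAt_id x).mul (PP_deriv ν β hα hx))
    refine h.congr_deriv ?_
    simp only [id, ww]; ring
  have hl : Tendsto (fun x => x * pp ν α β x + x * PP ν α β x) (nhdsWithin 0 (Set.Ioi 0)) (nhds 0) := by
    have := (xpp_tendsto β hν hα).add (id_tendsto0.mul (PP_tendsto β hν hα))
    simpa using this
  have hi : Integrable (fun x => x * pp ν α β x + x * PP ν α β x) := by
    have := i1.add (tPP_integrable hν hα hβ 1)
    refine this.congr (Eventually.of_forall fun t => ?_)
    simp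
  have := int_Ioi_lim hd iI.neg.integrableOn hi.integrableOn hl
  rw [integral_neg] at this
  linarith

lemma gx_cont {ν : ℝ} (hν : -(1/2) < ν) (α : ℝ) :
    Continuous (fun x => gg ν (α ^ 2 * x ^ 2 / 4)) :=
  continuous_iff_continuousAt.2 fun x => (gx_deriv hν α x).continuousAt

lemma qq_intervalIntegrable {ν : ℝ} (α β : ℝ) (hν : -(1/2) < ν) (φ : ℝ → ℝ) (hφ : Continuous φ)
    (a b : ℝ) : IntervalIntegrable (fun t => qq ν α β t * φ t) volume a b := by
  have h1 := intervalIntegral.intervalIntegrable_rpow' (r := 2 * ν) (a := a) (b := b) (by linarith)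
  have h2 := h1.mul_continuousOn (g := fun t => Real.exp (β * t) * gg ν (α ^ 2 * t ^ 2 / 4) * φ t)
    (((by fun_prop : Continuous fun t : ℝ => Real.exp (β * t)).mul (gx_cont hν α)).mul hφ).continuousOn
  refine h2.congr (fun t _ => ?_)
  simp only [qq]; ring

lemma qq_nonneg {ν x : ℝ} (α β : ℝ) (hν : -(1/2) < ν) (hx : 0 ≤ x) : 0 ≤ qq ν α β x := by
  unfold qq
  have := (gg_pos hν (z := α ^ 2 * x ^ 2 / 4) (by positivity)).le
  positivity

lemma QQ_tendsto {ν : ℝ} (α β : ℝ) (hν : -(1/2) < ν) :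
    Tendsto (QQ ν α β) (nhdsWithin 0 (Set.Ioi 0)) (nhds 0) := by
  have hc : ContinuousAt (QQ ν α β) 0 := by
    unfold QQ
    have h1 : ContinuousAt (fun x : ℝ => x ^ (2 * ν + 1)) 0 :=
      Real.continuousAt_rpow_const _ _ (Or.inr (by linarith))
    have h2 := (gx_cont hν α).continuousAt (x := 0)
    have h3 := (gx_cont (ν := ν + 1) (by linarith) α).continuousAt (x := 0)
    exact ((by fun_prop : Continuous fun t : ℝ => Real.exp (β * t)).continuousAt.mul h1).mul
      (((by fun_prop : Continuous fun t : ℝ => α ^ 2 * t / 2).continuousAt.mul h3).sub (h2.const_mul β))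
  have := hc.tendsto
  have e : QQ ν α β 0 = 0 := by
    unfold QQ; rw [Real.zero_rpow (by linarith)]; ring
  rw [e] at this
  exact this.mono_left nhdsWithin_le_nhds

lemma ww_cont (ν α β : ℝ) : Continuous (ww ν α β) := by unfold ww; fun_prop

lemma int_wqq {ν x : ℝ} (α β : ℝ) (hν : -(1/2) < ν) (hx : 0 < x) :
    ∫ t in (0:ℝ)..x, qq ν α β t * ww ν α β t = QQ ν α β x := by
  have := intervalIntegral.integral_eq_sub_of_hasDerivAt_of_tendsto hx
    (f := QQ ν α β) (f' := fun t => qq ν α β t * ww ν α β t)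
    (fun t ht => (QQ_deriv β hν ht.1).congr_deriv (mul_comm _ _))
    (qq_intervalIntegrable α β hν _ (ww_cont _ _ _) 0 x) (QQ_tendsto α β hν)
    ((QQ_deriv β hν hx).continuousAt.tendsto.mono_left nhdsWithin_le_nhds)
  rw [this, sub_zero]

lemma PP_nonneg {ν α β x : ℝ} (hν : -(1/2) < ν) (hα : 0 < α) (hβ : β ^ 2 < α ^ 2) (hx : 0 < x) :
    0 ≤ PP ν α β x := by
  rcases le_total 0 β with hb | hb
  · unfold PP
    have := jj_nonneg (ν + 1) (α ^ 2 * x ^ 2 / 4)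
    have := jj_nonneg ν (α ^ 2 * x ^ 2 / 4)
    positivity
  · rw [← int_wpp hν hα hβ hx]
    refine setIntegral_nonneg measurableSet_Ioi fun t ht => mul_nonneg ?_ (pp_nonneg _ _ _ _)
    have : x < t := ht
    unfold ww
    have h1 : 0 ≤ (α ^ 2 - β ^ 2) * t := mul_nonneg (by linarith) (by linarith)
    have h2 : (2 * ν + 1) * β ≤ 0 := mul_nonpos_of_nonneg_of_nonpos (by linarith) hb
    linarith

lemma key_sign {ν α β x : ℝ} (hν : -(1/2) < ν) (hα : 0 < α) (hβ : β ^ 2 < α ^ 2) (hx : 0 < x) :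
    QQ ν α β x * (∫ t in Set.Ioi x, pp ν α β t) ≤ PP ν α β x * ∫ t in (0:ℝ)..x, qq ν α β t := by
  have hP := PP_nonneg hν hα hβ hx
  have hIp : 0 ≤ ∫ t in Set.Ioi x, pp ν α β t := integral_nonneg fun t => pp_nonneg _ _ _ _
  have hIq : 0 ≤ ∫ t in (0:ℝ)..x, qq ν α β t :=
    intervalIntegral.integral_nonneg hx.le fun t ht => qq_nonneg α β hν ht.1
  have hqi : IntervalIntegrable (qq ν α β) volume 0 x := by
    simpa using qq_intervalIntegrable α β hν (fun _ => 1) continuous_const 0 x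
  have hwi := qq_intervalIntegrable α β hν _ (ww_cont ν α β) 0 x
  have hmono : ∀ s t, s ≤ t → ww ν α β s ≤ ww ν α β t := by
    intro s t hst
    unfold ww; nlinarith
  rcases le_or_gt (QQ ν α β x) 0 with hQ | hQ
  · exact (mul_nonpos_of_nonpos_of_nonneg hQ hIp).trans (mul_nonneg hP hIq)
  · have hQle : QQ ν α β x ≤ ww ν α β x * ∫ t in (0:ℝ)..x, qq ν α β t := by
      rw [← int_wqq α β hν hx, ← intervalIntegral.integral_const_mul]
      refine intervalIntegral.integral_mono_on hx.le hwi (hqi.const_mul _) fun t ht => ?_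
      rw [mul_comm]
      exact mul_le_mul_of_nonneg_right (hmono t x ht.2) (qq_nonneg α β hν ht.1)
    have hPle : ww ν α β x * (∫ t in Set.Ioi x, pp ν α β t) ≤ PP ν α β x := by
      rw [← int_wpp hν hα hβ hx, ← integral_const_mul]
      refine setIntegral_mono_on ((pp_integrable hν hα hβ).const_mul _).integrableOn
        (wpp_integrable hν hα hβ).integrableOn measurableSet_Ioi fun t ht => ?_
      exact mul_le_mul_of_nonneg_right (hmono x t (le_of_lt ht)) (pp_nonneg _ _ _ _)
    have hw : 0 < ww ν α β x := by
      by_contra hcon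
      push Not at hcon
      have := mul_nonpos_of_nonpos_of_nonneg hcon hIq
      linarith
    have h1 := mul_le_mul_of_nonneg_left hPle hQ.le
    have h2 := mul_le_mul_of_nonneg_left hQle hP
    refine le_of_mul_le_mul_left ?_ hw
    nlinarith

noncomputable def UU (ν α β x : ℝ) : ℝ :=
  AA ν α β x * (∫ t in (0:ℝ)..x, qq ν α β t) + BB ν α β x * (∫ t in Set.Ioi x, pp ν α β t)

lemma qq_contAt {ν x : ℝ} (α β : ℝ) (hν : -(1/2) < ν) (hx : 0 < x) : ContinuousAt (qq ν α β) x := by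
  unfold qq
  have h1 : ContinuousAt (fun x : ℝ => x ^ (2 * ν)) x :=
      Real.continuousAt_rpow_const _ _ (Or.inl hx.ne')
  exact ((by fun_prop : Continuous fun t : ℝ => Real.exp (β * t)).continuousAt.mul h1).mul
    (gx_cont hν α).continuousAt

lemma UU_deriv {ν α β x : ℝ} (hν : -(1/2) < ν) (hα : 0 < α) (hβ : β ^ 2 < α ^ 2) (hx : 0 < x) :
    HasDerivAt (UU ν α β) (x ^ (-(2 * ν) - 1) * Real.exp (-(β * x)) * Real.exp (-(β * x)) *
      (QQ ν α β x * (∫ t in Set.Ioi x, pp ν α β t) -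
        PP ν α β x * ∫ t in (0:ℝ)..x, qq ν α β t)) x := by
  have hqi : IntervalIntegrable (qq ν α β) volume 0 x := by
    simpa using qq_intervalIntegrable α β hν (fun _ => 1) continuous_const 0 x
  have hp := pp_integrable hν hα hβ
  have hqd : HasDerivAt (fun x => ∫ t in (0:ℝ)..x, qq ν α β t) (qq ν α β x) x := by
    refine intervalIntegral.integral_hasDerivAt_right hqi ?_ (qq_contAt α β hν hx)
    exact ContinuousAt.stronglyMeasurableAtFilter isOpen_Ioi
      (fun y hy => qq_contAt α β hν hy) x hx
  have hpd0 : HasDerivAt (fun x => ∫ t in (0:ℝ)..x, pp ν α β t) (pp ν α β x) x := by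
    refine intervalIntegral.integral_hasDerivAt_right hp.intervalIntegrable ?_
      (pp_deriv ν β hα hx).continuousAt
    exact ContinuousAt.stronglyMeasurableAtFilter isOpen_Ioi
      (fun y hy => (pp_deriv ν β hα hy).continuousAt) x hx
  have hpd : HasDerivAt (fun x => ∫ t in Set.Ioi x, pp ν α β t) (-pp ν α β x) x := by
    have e : (fun x => ∫ t in Set.Ioi x, pp ν α β t) =
        fun x => (∫ t in Set.Ioi 0, pp ν α β t) - ∫ t in (0:ℝ)..x, pp ν α β t := by
      ext y
      rw [← intervalIntegral.integral_Ioi_sub_Ioi' hp.integrableOn hp.integrableOn]; ring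
    rw [e]
    exact hpd0.const_sub _
  have h := ((AA_deriv ν β hα hx).mul hqd).add ((BB_deriv (α := α) β hν hx).mul hpd)
  refine h.congr_deriv ?_
  have e1 := AAqq (ν := ν) (α := α) β hx
  have e2 := BBpp ν α β x
  linear_combination e1 - e2

lemma UU_anti {ν α β : ℝ} (hν : -(1/2) < ν) (hα : 0 < α) (hβ : β ^ 2 < α ^ 2) :
    AntitoneOn (UU ν α β) (Set.Ioi 0) := by
  refine antitoneOn_of_deriv_nonpos (convex_Ioi 0)
    (fun x hx => (UU_deriv hν hα hβ hx).continuousAt.continuousWithinAt) ?_ ?_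
  · rw [interior_Ioi]
    exact fun x hx => (UU_deriv hν hα hβ hx).differentiableAt.differentiableWithinAt
  · rw [interior_Ioi]
    intro x hx
    have hx' : (0:ℝ) < x := hx
    rw [(UU_deriv hν hα hβ hx).deriv]
    have := key_sign hν hα hβ hx'
    exact mul_nonpos_of_nonneg_of_nonpos (by positivity) (by linarith)

lemma AAq_tendsto {ν α : ℝ} (β : ℝ) (hν : -(1/2) < ν) (hα : 0 < α) :
    Tendsto (fun x => AA ν α β x * ∫ t in (0:ℝ)..x, qq ν α β t)
      (nhdsWithin 0 (Set.Ioi 0)) (nhds 0) := by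
  have hcont : Continuous fun t : ℝ => Real.exp (β * t) * gg ν (α ^ 2 * t ^ 2 / 4) :=
    (by fun_prop : Continuous fun t : ℝ => Real.exp (β * t)).mul (gx_cont hν α)
  obtain ⟨C, hC⟩ := (isCompact_Icc (a := (0:ℝ)) (b := 1)).exists_bound_of_continuousOn
    hcont.continuousOn
  have hlim : Tendsto (fun x : ℝ => (C / (2 * ν + 1)) *
      (Real.exp (-β * x) * (x * jj ν (α ^ 2 * x ^ 2 / 4)))) (nhdsWithin 0 (Set.Ioi 0)) (nhds 0) := by
    have := ((exp_tendsto0 (-β)).mul (xjj_tendsto hν hα)).const_mul (C / (2 * ν + 1))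
    simpa using this
  refine squeeze_zero' ?_ ?_ hlim
  · filter_upwards [self_mem_nhdsWithin] with x hx
    have hx' : (0:ℝ) < x := hx
    have h1 : 0 ≤ AA ν α β x := by
      unfold AA; have := jj_nonneg ν (α ^ 2 * x ^ 2 / 4); positivity
    exact mul_nonneg h1 (intervalIntegral.integral_nonneg hx'.le fun t ht => qq_nonneg α β hν ht.1)
  · filter_upwards [self_mem_nhdsWithin, nhdsWithin_le_nhds (Iio_mem_nhds (zero_lt_one' ℝ))] with x hx hx1
    have hx' : (0:ℝ) < x := hx
    have hx1' : x < 1 := hx1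
    have h1 : 0 ≤ AA ν α β x := by
      unfold AA; have := jj_nonneg ν (α ^ 2 * x ^ 2 / 4); positivity
    have hqi : IntervalIntegrable (qq ν α β) volume 0 x := by
      simpa using qq_intervalIntegrable α β hν (fun _ => 1) continuous_const 0 x
    have hri := intervalIntegral.intervalIntegrable_rpow' (r := 2 * ν) (a := 0) (b := x) (by linarith)
    have h2 : ∫ t in (0:ℝ)..x, qq ν α β t ≤ C * (x ^ (2 * ν + 1) / (2 * ν + 1)) := by
      have e : ∫ t in (0:ℝ)..x, t ^ (2 * ν) = x ^ (2 * ν + 1) / (2 * ν + 1) := by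
        rw [integral_rpow (Or.inl (by linarith)), Real.zero_rpow (by linarith), sub_zero]
      rw [← e, ← intervalIntegral.integral_const_mul]
      refine intervalIntegral.integral_mono_on hx'.le hqi (hri.const_mul _) fun t ht => ?_
      have h3 := (le_abs_self _).trans (hC t ⟨ht.1, ht.2.trans hx1'.le⟩)
      have h4 : (0:ℝ) ≤ t ^ (2 * ν) := Real.rpow_nonneg ht.1 _
      unfold qq
      nlinarith [mul_le_mul_of_nonneg_right h3 h4]
    refine (mul_le_mul_of_nonneg_left h2 h1).trans (le_of_eq ?_)
    unfold AA
    have e : x ^ (-(2 * ν)) * x ^ (2 * ν + 1) = x := by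
      rw [← Real.rpow_add hx']; simp
    rw [neg_mul]
    linear_combination (C / (2 * ν + 1) * Real.exp (-(β * x)) * jj ν (α ^ 2 * x ^ 2 / 4)) * e

lemma UU_le {ν α β x : ℝ} (hν : -(1/2) < ν) (hα : 0 < α) (hβ : β ^ 2 < α ^ 2) (hx : 0 < x) :
    UU ν α β x ≤ (Real.Gamma (ν + 1))⁻¹ * ∫ t, pp ν α β t := by
  have hp := pp_integrable hν hα hβ
  have hB : Tendsto (BB ν α β) (nhdsWithin 0 (Set.Ioi 0)) (nhds (Real.Gamma (ν + 1))⁻¹) := by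
    have hc : Continuous (BB ν α β) :=
      (by fun_prop : Continuous fun t : ℝ => Real.exp (-(β * t))).mul (gx_cont hν α)
    have := hc.tendsto 0
    have e : BB ν α β 0 = (Real.Gamma (ν + 1))⁻¹ := by
      unfold BB; rw [← gg_zero]; simp
    rw [e] at this
    exact this.mono_left nhdsWithin_le_nhds
  have hl := (AAq_tendsto β hν hα).add (hB.mul_const (∫ t, pp ν α β t))
  rw [zero_add] at hl
  refine ge_of_tendsto hl ?_
  filter_upwards [self_mem_nhdsWithin, nhdsWithin_le_nhds (Iio_mem_nhds hx)] with y hy hyx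
  refine (UU_anti hν hα hβ hy hx (le_of_lt hyx)).trans ?_
  unfold UU
  have hB0 : 0 ≤ BB ν α β y := by
    unfold BB
    exact mul_nonneg (Real.exp_pos _).le (gg_pos hν (by positivity)).le
  have := setIntegral_le_integral hp (s := Set.Ioi y) (Eventually.of_forall fun t => pp_nonneg _ _ _ _)
  have := mul_le_mul_of_nonneg_left this hB0
  linarith


lemma gam_half {y : ℝ} (hy : 0 < y) : Real.Gamma (y + 1/2) ^ 2 ≤ y * Real.Gamma y ^ 2 := by
  have h := Real.Gamma_mul_add_mul_le_rpow_Gamma_mul_rpow_Gamma (s := y) (t := y + 1) (a := 1/2) (b := 1/2)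
    hy (by linarith) (by norm_num) (by norm_num) (by norm_num)
  rw [show (1/2 : ℝ) * y + 1/2 * (y + 1) = y + 1/2 by ring, ← Real.sqrt_eq_rpow, ← Real.sqrt_eq_rpow,
    Real.Gamma_add_one hy.ne'] at h
  have hg := Real.Gamma_pos_of_pos hy
  have hg2 := Real.Gamma_pos_of_pos (show 0 < y + 1/2 by linarith)
  calc _ ≤ (√(Real.Gamma y) * √(y * Real.Gamma y)) ^ 2 := by gcongr
    _ = _ := by
      rw [mul_pow, Real.sq_sqrt hg.le, Real.sq_sqrt (by positivity)]; ring

lemma gphi_step {x : ℝ} (hx : 1 ≤ x) :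
    Real.Gamma x ^ 2 * (x - 1/4) / Real.Gamma (x + 1/2) ^ 2 ≤
    Real.Gamma (x + 1) ^ 2 * ((x + 1) - 1/4) / Real.Gamma ((x + 1) + 1/2) ^ 2 := by
  have e1 := Real.Gamma_add_one (s := x) (by linarith)
  have e2 := Real.Gamma_add_one (s := x + 1/2) (by linarith)
  rw [show x + 1 + 1/2 = x + 1/2 + 1 by ring, e1, e2]
  have h1 := Real.Gamma_pos_of_pos (show 0 < x by linarith)
  have h2 := Real.Gamma_pos_of_pos (show 0 < x + 1/2 by linarith)
  have hx2 : 0 < x + 1/2 := by linarith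
  rw [div_le_div_iff₀ (by positivity) (by positivity)]
  have : (x - 1/4) * (x + 1/2) ^ 2 ≤ x ^ 2 * (x + 1 - 1/4) := by nlinarith
  have := mul_le_mul_of_nonneg_left this (show 0 ≤ Real.Gamma x ^ 2 * Real.Gamma (x + 1/2) ^ 2 by positivity)
  nlinarith

lemma gphi_n {x : ℝ} (hx : 1 ≤ x) (n : ℕ) :
    Real.Gamma x ^ 2 * (x - 1/4) / Real.Gamma (x + 1/2) ^ 2 ≤
    Real.Gamma (x + n) ^ 2 * ((x + n) - 1/4) / Real.Gamma ((x + n) + 1/2) ^ 2 := by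
  induction n with
  | zero => simp
  | succ n ih =>
    refine ih.trans ?_
    have := gphi_step (x := x + n) (by have : (0:ℝ) ≤ n := n.cast_nonneg
                                       linarith)
    push_cast
    rw [← add_assoc]; exact this

lemma gphi_bd {y : ℝ} (hy : 1 ≤ y) :
    Real.Gamma y ^ 2 * (y - 1/4) / Real.Gamma (y + 1/2) ^ 2 ≤ (y - 1/4) / (y - 1/2) := by
  have h := gam_half (y := y - 1/2) (by linarith)
  rw [show y - 1/2 + 1/2 = y by ring] at h
  have e := Real.Gamma_add_one (s := y - 1/2) (by linarith)
  rw [show y - 1/2 + 1 = y + 1/2 by ring] at e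
  rw [e]
  have h1 := Real.Gamma_pos_of_pos (show 0 < y - 1/2 by linarith)
  have h2 : 0 < y - 1/2 := by linarith
  rw [div_le_div_iff₀ (by positivity) (by positivity)]
  have h3 : 0 ≤ (y - 1/4) * (y - 1/2) := by nlinarith
  nlinarith [mul_le_mul_of_nonneg_right h h3]

lemma gphi_le {x : ℝ} (hx : 1 ≤ x) :
    Real.Gamma x ^ 2 * (x - 1/4) / Real.Gamma (x + 1/2) ^ 2 ≤ 1 := by
  have hl : Tendsto (fun n : ℕ => 1 + (1/4 : ℝ) * (x - 1/2 + n)⁻¹) atTop (nhds (1 + 1/4 * 0)) := by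
    refine tendsto_const_nhds.add (Tendsto.const_mul _ ?_)
    exact tendsto_inv_atTop_zero.comp (tendsto_atTop_add_const_left _ _ tendsto_natCast_atTop_atTop)
  rw [mul_zero, add_zero] at hl
  refine ge_of_tendsto' hl fun n => ?_
  have hn : (0:ℝ) ≤ n := n.cast_nonneg
  refine (gphi_n hx n).trans ((gphi_bd (by linarith)).trans (le_of_eq ?_))
  have : x - 1/2 + n ≠ 0 := by linarith
  have : x + n - 1/2 ≠ 0 := by linarith
  rw [show x - 1/2 + n = x + n - 1/2 by ring]
  rw [div_eq_iff this, add_mul, mul_assoc, inv_mul_cancel₀ this]; ring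

noncomputable def Gc (r : ℝ) : ℝ := √π * Real.Gamma (r / 2) / Real.Gamma ((r + 1) / 2)

lemma Gc_pos {r : ℝ} (hr : 0 < r) : 0 < Gc r := by
  unfold Gc
  have h1 := Real.Gamma_pos_of_pos (show 0 < r/2 by linarith)
  have h2 := Real.Gamma_pos_of_pos (show 0 < (r+1)/2 by linarith)
  have := Real.pi_pos
  positivity

lemma rGc {r : ℝ} (hr : 0 < r) : r * Gc r ≤ √(2 * π * (r + 1)) := by
  have h1 := Real.Gamma_pos_of_pos (show 0 < r/2 by linarith)
  have h2 := Real.Gamma_pos_of_pos (show 0 < (r+1)/2 by linarith)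
  apply Real.le_sqrt_of_sq_le
  have h := gam_half (y := (r+1)/2) (by linarith)
  rw [show (r+1)/2 + 1/2 = r/2 + 1 by ring, Real.Gamma_add_one (by linarith)] at h
  unfold Gc
  rw [mul_pow, div_pow, mul_pow, Real.sq_sqrt Real.pi_pos.le, ← mul_div_assoc, div_le_iff₀ (by positivity)]
  nlinarith [mul_le_mul_of_nonneg_left h Real.pi_pos.le]

lemma Gc_large {r : ℝ} (hr : 2 ≤ r) : Gc r ≤ 2 * √π / √(2 * r - 1) := by
  have h := gphi_le (x := r/2) (by linarith)
  have h1 := Real.Gamma_pos_of_pos (show 0 < r/2 by linarith)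
  have h2 := Real.Gamma_pos_of_pos (show 0 < (r+1)/2 by linarith)
  rw [show r/2+1/2 = (r+1)/2 by ring, div_le_one (by positivity)] at h
  unfold Gc
  have hs : 0 < √(2 * r - 1) := Real.sqrt_pos.2 (by linarith)
  rw [div_le_div_iff₀ h2 hs]
  have : Real.Gamma (r/2) * √(2*r-1) ≤ 2 * Real.Gamma ((r+1)/2) := by
    apply le_of_sq_le_sq _ (by positivity)
    rw [mul_pow, Real.sq_sqrt (by linarith)]
    nlinarith
  nlinarith [mul_le_mul_of_nonneg_left this (Real.sqrt_nonneg π)]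

lemma gam_low {y : ℝ} (hy : 1/2 < y) (hy2 : y < 3/2) : 1/6 ≤ Real.Gamma y := by
  have h1 := Real.Gamma_pos_of_pos (show 0 < y by linarith)
  have h2 := Real.Gamma_pos_of_pos (show 0 < 4 - y by linarith)
  have b := Real.Gamma_mul_add_mul_le_rpow_Gamma_mul_rpow_Gamma (s := y) (t := 4 - y) (a := 1/2) (b := 1/2)
    (by linarith) (by linarith) (by norm_num) (by norm_num) (by norm_num)
  rw [show (1/2 : ℝ) * y + 1/2 * (4 - y) = 2 by ring, ← Real.sqrt_eq_rpow, ← Real.sqrt_eq_rpow,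
    Real.Gamma_two, ← Real.sqrt_mul h1.le] at b
  have c : (1:ℝ) ≤ Real.Gamma y * Real.Gamma (4 - y) := by
    have := Real.one_le_sqrt.1 b
    exact this
  have d : Real.Gamma (4 - y) ≤ 6 := by
    have h3 := Real.Gamma_strictMonoOn_Ici.monotoneOn (a := 4 - y) (b := 4)
      (by simp only [Set.mem_Ici]; linarith) (by simp only [Set.mem_Ici]; norm_num) (by linarith)
    have h4 : Real.Gamma 4 = 6 := by
      rw [show (4:ℝ) = ((3:ℕ):ℝ) + 1 by norm_num, Real.Gamma_nat_eq_factorial 3]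
      norm_num [Nat.factorial]
    rw [h4] at h3
    exact h3
  nlinarith

lemma Gc_A {r : ℝ} (θ : ℝ) {σ : ℝ} (hr : 0 < r) :
    (1 + θ ^ 2 / σ ^ 2) ^ (r / 2) * Gc r ≤ Aconst r θ σ := by
  have hb : 1 ≤ 1 + θ ^ 2 / σ ^ 2 := by
    have : 0 ≤ θ ^ 2 / σ ^ 2 := by positivity
    linarith
  have hG := Gc_pos hr
  unfold Aconst
  split_ifs with h2
  · rw [mul_comm]
    have := Gc_large h2
    gcongr
  · push Not at h2
    have h3 : (1 + θ ^ 2 / σ ^ 2) ^ (r / 2) ≤ 1 + θ ^ 2 / σ ^ 2 := by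
      calc _ ≤ (1 + θ ^ 2 / σ ^ 2) ^ (1:ℝ) := Real.rpow_le_rpow_of_exponent_le hb (by linarith)
        _ = _ := Real.rpow_one _
    have h4 : Gc r ≤ 12 * Real.Gamma (r / 2) := by
      have g := gam_low (y := (r+1)/2) (by linarith) (by linarith)
      have h1 := Real.Gamma_pos_of_pos (show 0 < r/2 by linarith)
      have hp : √π ≤ 2 := by
        rw [Real.sqrt_le_left (by norm_num)]
        have := Real.pi_lt_four
        linarith
      unfold Gc
      rw [div_le_iff₀ (by linarith)]
      nlinarith [mul_le_mul_of_nonneg_right hp h1.le, mul_le_mul_of_nonneg_left g h1.le]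
    calc _ ≤ (1 + θ ^ 2 / σ ^ 2) * (12 * Real.Gamma (r / 2)) := by gcongr
      _ = _ := by ring

lemma final_ineq {r : ℝ} (θ : ℝ) {σ : ℝ} (hr : 0 < r) (hσ : 0 < σ) :
    1 + (2 * (r * |θ|) + √(r * (σ ^ 2 + 2 * θ ^ 2))) *
      (1 / σ * (1 + θ ^ 2 / σ ^ 2) ^ ((r - 1) / 2) * Gc r) ≤
    4 + 2 * √2 / √r + √(2 * π * (r + 1)) * (|θ| / σ) * (1 + θ ^ 2 / σ ^ 2) ^ ((r - 1) / 2) +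
          (√(2 * r) + r) * Aconst r θ σ := by
  have hA := Gc_A θ (σ := σ) hr
  have hG := Gc_pos hr
  have hR := rGc hr
  have hb : 0 < 1 + θ ^ 2 / σ ^ 2 := by positivity
  set b := 1 + θ ^ 2 / σ ^ 2 with hbdef
  have e : b ^ (r / 2) = √b * b ^ ((r - 1) / 2) := by
    rw [Real.sqrt_eq_rpow, ← Real.rpow_add hb]; congr 1; ring
  have h1 : |θ| / σ ≤ √b := by
    apply Real.le_sqrt_of_sq_le
    rw [div_pow, sq_abs, hbdef]; linarith
  have h2 : √(r * (σ ^ 2 + 2 * θ ^ 2)) / σ ≤ √(2 * r) * √b := by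
    rw [← Real.sqrt_mul (by positivity)]
    apply Real.le_sqrt_of_sq_le
    rw [div_pow, Real.sq_sqrt (by positivity), hbdef, div_le_iff₀ (by positivity)]
    field_simp
    nlinarith [sq_nonneg σ]
  have hc : 0 < b ^ ((r - 1) / 2) := by positivity
  set c := b ^ ((r - 1) / 2) with hcdef
  have h0 : 0 ≤ 2 * √2 / √r := by positivity
  have k1 : (r * Gc r) * (|θ| / σ) * c ≤ √(2 * π * (r + 1)) * (|θ| / σ) * c := by gcongr
  have k2 : r * (|θ| / σ) * (c * Gc r) ≤ r * √b * (c * Gc r) := by gcongr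
  have k3 : √(r * (σ ^ 2 + 2 * θ ^ 2)) / σ * (c * Gc r) ≤ √(2 * r) * √b * (c * Gc r) := by gcongr
  have k4 := mul_le_mul_of_nonneg_left hA (show 0 ≤ √(2 * r) + r by positivity)
  rw [e] at k4
  have k5 : (2 * (r * |θ|) + √(r * (σ ^ 2 + 2 * θ ^ 2))) * (1 / σ * c * Gc r) =
    (r * Gc r) * (|θ| / σ) * c + r * (|θ| / σ) * (c * Gc r) +
      √(r * (σ ^ 2 + 2 * θ ^ 2)) / σ * (c * Gc r) := by ring
  rw [k5]
  linarith


lemma int_split {F : ℝ → ℝ} (hF : Integrable F) :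
    ∫ t, F t = (∫ t in Set.Ioi (0:ℝ), F t) + ∫ t in Set.Ioi (0:ℝ), F (-t) := by
  rw [integral_comp_neg_Ioi, neg_zero, add_comm]
  exact (intervalIntegral.integral_Iic_add_Ioi hF.integrableOn hF.integrableOn).symm

lemma mom1 {ν α β : ℝ} (hν : -(1/2) < ν) (hα : 0 < α) (hβ : β ^ 2 < α ^ 2) :
    ∫ t, ww ν α β t * pp ν α β t = 0 := by
  rw [int_split (wpp_integrable hν hα hβ), int_wpp0 hν hα hβ]
  have : ∀ t, ww ν α β (-t) * pp ν α β (-t) = -(ww ν α (-β) t * pp ν α (-β) t) := by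
    intro t; rw [pp_neg]; unfold ww; ring
  simp only [this]
  rw [integral_neg, int_wpp0 hν hα (by simpa using hβ)]
  ring

lemma lin3_int {f g k : ℝ → ℝ} (hf : Integrable f) (hg : Integrable g) (hk : Integrable k) (a b c : ℝ) :
    Integrable (fun t => a * f t - b * g t - c * k t) :=
  ((hf.const_mul a).sub (hg.const_mul b)).sub (hk.const_mul c)

lemma lin3_eq {f g k : ℝ → ℝ} (hf : Integrable f) (hg : Integrable g) (hk : Integrable k) (a b c : ℝ) :
    ∫ t, (a * f t - b * g t - c * k t) = a * (∫ t, f t) - b * (∫ t, g t) - c * ∫ t, k t := by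
  have h : Integrable (fun t => a * f t - b * g t) := (hf.const_mul a).sub (hg.const_mul b)
  rw [integral_sub h (hk.const_mul c), integral_sub (hf.const_mul a) (hg.const_mul b),
    integral_const_mul, integral_const_mul, integral_const_mul]

lemma mom2 {ν α β : ℝ} (hν : -(1/2) < ν) (hα : 0 < α) (hβ : β ^ 2 < α ^ 2) :
    ∫ t, ((α ^ 2 - β ^ 2) * (t ^ 2 * pp ν α β t) -
      (2 * ν + 3) * β * (t ^ 1 * pp ν α β t) - (2 * ν + 1) * (t ^ 0 * pp ν α β t)) = 0 := by
  have i0 := tpp_integrable hν hα hβ 0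
  have i1 := tpp_integrable hν hα hβ 1
  have i2 := tpp_integrable hν hα hβ 2
  rw [int_split (lin3_int i2 i1 i0 _ _ _), int_sq0 hν hα hβ]
  have h := int_sq0 (β := -β) hν hα (by simpa using hβ)
  rw [zero_add]
  refine Eq.trans ?_ h
  refine integral_congr_ae (Eventually.of_forall fun t => ?_)
  simp only [pp_neg]; ring

lemma var_int {ν α β : ℝ} (hν : -(1/2) < ν) (hα : 0 < α) (hβ : β ^ 2 < α ^ 2) :
    Integrable (fun t => (t - (2 * ν + 1) * β / (α ^ 2 - β ^ 2)) ^ 2 * pp ν α β t) ∧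
    ∫ t, (t - (2 * ν + 1) * β / (α ^ 2 - β ^ 2)) ^ 2 * pp ν α β t =
      ((2 * ν + 1) / (α ^ 2 - β ^ 2) * (1 + 2 * β ^ 2 / (α ^ 2 - β ^ 2))) * ∫ t, pp ν α β t := by
  have i0 := pp_integrable hν hα hβ
  have i1 := tpp_integrable hν hα hβ 1
  have i2 := tpp_integrable hν hα hβ 2
  have ha : 0 < α ^ 2 - β ^ 2 := by linarith
  have m1 := mom1 hν hα hβ
  have m2 := mom2 hν hα hβ
  have e0 : ∀ t, t ^ 0 * pp ν α β t = pp ν α β t := by intro t; simp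
  simp only [e0] at m2
  rw [lin3_eq i2 i1 i0] at m2
  have e1 : ∀ t, ww ν α β t * pp ν α β t = (α ^ 2 - β ^ 2) * (t ^ 1 * pp ν α β t) -
      (2 * ν + 1) * β * pp ν α β t := by intro t; unfold ww; ring
  simp only [e1] at m1
  rw [integral_sub (i1.const_mul _) (i0.const_mul _), integral_const_mul, integral_const_mul] at m1
  set a := α ^ 2 - β ^ 2
  set m := (2 * ν + 1) * β / a with hm
  have hma : a * m = (2 * ν + 1) * β := by rw [hm]; field_simp
  have e2 : ∀ t, (t - m) ^ 2 * pp ν α β t = 1 * (t ^ 2 * pp ν α β t) - 2 * m * (t ^ 1 * pp ν α β t) -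
      (-m ^ 2) * pp ν α β t := by intro t; ring
  simp only [e2]
  refine ⟨lin3_int i2 i1 i0 _ _ _, ?_⟩
  rw [lin3_eq i2 i1 i0]
  set M := ∫ t, pp ν α β t
  set S1 := ∫ t, t ^ 1 * pp ν α β t
  set S2 := ∫ t, t ^ 2 * pp ν α β t
  have hS1 : S1 = m * M := by
    rw [hm]; field_simp; linarith
  have hS2 : S2 = ((2 * ν + 3) * β * S1 + (2 * ν + 1) * M) / a := by
    field_simp; linarith
  rw [hS2, hS1, hm]
  field_simp
  ring

lemma lip_cont {h : ℝ → ℝ} {L : ℝ} (hlip : ∀ u v : ℝ, |h u - h v| ≤ L * |u - v|) : Continuous h := by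
  have hL : 0 ≤ L := by
    have := (abs_nonneg _).trans (hlip 1 0)
    simpa using this
  refine (LipschitzWith.of_dist_le_mul (K := ⟨L, hL⟩) fun u v => ?_).continuous
  exact hlip u v

lemma hpp_integrable {ν α β : ℝ} (hν : -(1/2) < ν) (hα : 0 < α) (hβ : β ^ 2 < α ^ 2)
    {h : ℝ → ℝ} {L : ℝ} (hlip : ∀ u v : ℝ, |h u - h v| ≤ L * |u - v|) :
    Integrable (fun t => h t * pp ν α β t) := by
  have i0 := pp_integrable hν hα hβ
  have i1 := (tpp_integrable hν hα hβ 1).norm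
  refine ((i1.const_mul L).add (i0.const_mul |h 0|)).mono'
    ((lip_cont hlip).aestronglyMeasurable.mul i0.aestronglyMeasurable)
    (Eventually.of_forall fun t => ?_)
  have hp := pp_nonneg ν α β t
  simp only [Pi.add_apply, Real.norm_eq_abs, abs_mul, pow_one, abs_of_nonneg hp]
  have h1 := hlip t 0
  rw [sub_zero] at h1
  have h2 : |h t| ≤ L * |t| + |h 0| := by
    have := abs_add_le (h t - h 0) (h 0)
    rw [sub_add_cancel] at this
    linarith
  nlinarith [mul_le_mul_of_nonneg_right h2 hp]

lemma H_bound {ν α β : ℝ} (hν : -(1/2) < ν) (hα : 0 < α) (hβ : β ^ 2 < α ^ 2)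
    {h : ℝ → ℝ} {L : ℝ} (hL : 0 ≤ L) (hlip : ∀ u v : ℝ, |h u - h v| ≤ L * |u - v|)
    {c0 : ℝ} (hc0 : c0 * ∫ t, pp ν α β t = ∫ t, h t * pp ν α β t) (hM : 0 < ∫ t, pp ν α β t) (t : ℝ) :
    |h t - c0| ≤ L * (|t - (2 * ν + 1) * β / (α ^ 2 - β ^ 2)| +
      √((2 * ν + 1) / (α ^ 2 - β ^ 2) * (1 + 2 * β ^ 2 / (α ^ 2 - β ^ 2)))) := by
  obtain ⟨iv, ev⟩ := var_int hν hα hβ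
  have i0 := pp_integrable hν hα hβ
  have ih := hpp_integrable hν hα hβ hlip
  have ha : 0 < α ^ 2 - β ^ 2 := by linarith
  have hr : 0 < 2 * ν + 1 := by linarith
  set a := α ^ 2 - β ^ 2
  set m := (2 * ν + 1) * β / a with hm
  have hV : 0 < (2 * ν + 1) / a * (1 + 2 * β ^ 2 / a) := by positivity
  set V := (2 * ν + 1) / a * (1 + 2 * β ^ 2 / a)
  have hc : 0 < √V := Real.sqrt_pos.2 hV
  have hcc : √V * √V = V := Real.mul_self_sqrt hV.le
  set c := √V
  set M := ∫ t, pp ν α β t with hMdef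
  have e1 : (h t - c0) * M = ∫ s, (h t * pp ν α β s - h s * pp ν α β s) := by
    rw [integral_sub (i0.const_mul _) ih, integral_const_mul, ← hc0]; ring
  have e2 : |(h t - c0) * M| ≤ ∫ s, (L * (|t - m| + c / 2) * pp ν α β s +
      L * (1 / (2 * c)) * ((s - m) ^ 2 * pp ν α β s)) := by
    rw [e1]
    rw [← Real.norm_eq_abs]
    refine norm_integral_le_of_norm_le (by exact (i0.const_mul _).add (iv.const_mul _))
      (Eventually.of_forall fun s => ?_)
    have hp := pp_nonneg ν α β s
    rw [← sub_mul, norm_mul, Real.norm_eq_abs, Real.norm_eq_abs, abs_of_nonneg hp]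
    have h1 : |t - s| ≤ |t - m| + |s - m| := by
      rw [abs_sub_comm s m]; exact abs_sub_le t m s
    have h2 : |s - m| ≤ c / 2 + 1 / (2 * c) * (s - m) ^ 2 := by
      rw [← sq_abs (s - m)]
      have : c / 2 + 1 / (2 * c) * |s - m| ^ 2 - |s - m| = 1 / (2 * c) * (c - |s - m|) ^ 2 := by
        field_simp; ring
      have : 0 ≤ 1 / (2 * c) * (c - |s - m|) ^ 2 := by positivity
      linarith
    have h3 : |h t - h s| ≤ L * (|t - m| + c / 2) + L * (1 / (2 * c)) * (s - m) ^ 2 := by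
      refine (hlip t s).trans ?_
      have := mul_le_mul_of_nonneg_left (h1.trans (add_le_add_right h2 _)) hL
      linarith
    have := mul_le_mul_of_nonneg_right h3 hp
    linarith
  rw [integral_add (i0.const_mul _) (iv.const_mul _), integral_const_mul, integral_const_mul, ev,
    abs_mul, abs_of_pos hM, ← hMdef] at e2
  have e3 : L * (|t - m| + c / 2) * M + L * (1 / (2 * c)) * (V * M) = L * (|t - m| + c) * M := by
    rw [← hcc]; field_simp; ring
  rw [e3] at e2
  exact le_of_mul_le_mul_right e2 hM

lemma AA_nonneg (ν α β : ℝ) {x : ℝ} (hx : 0 < x) : 0 ≤ AA ν α β x := by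
  unfold AA; have := jj_nonneg ν (α ^ 2 * x ^ 2 / 4); positivity

lemma BB_nonneg {ν : ℝ} (α β x : ℝ) (hν : -(1/2) < ν) : 0 ≤ BB ν α β x := by
  unfold BB
  exact mul_nonneg (Real.exp_pos _).le (gg_pos hν (by positivity)).le

lemma main_abs {ν α β : ℝ} (hν : -(1/2) < ν) (hα : 0 < α) (hβ : β ^ 2 < α ^ 2)
    {h : ℝ → ℝ} {L : ℝ} (hL : 0 ≤ L) (hlip : ∀ u v : ℝ, |h u - h v| ≤ L * |u - v|)
    {c0 : ℝ} (hc0 : c0 * ∫ t, pp ν α β t = ∫ t, h t * pp ν α β t) (hM : 0 < ∫ t, pp ν α β t)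
    {x : ℝ} (hx : 0 < x) :
    |AA ν α β x * (∫ t in (0:ℝ)..x, qq ν α β t * (h t - c0)) +
      BB ν α β x * (∫ t in Set.Ioi x, pp ν α β t * (h t - c0))| ≤
    L * (2 / (α ^ 2 - β ^ 2) + (2 * |(2 * ν + 1) * β / (α ^ 2 - β ^ 2)| +
      √((2 * ν + 1) / (α ^ 2 - β ^ 2) * (1 + 2 * β ^ 2 / (α ^ 2 - β ^ 2)))) *
      ((Real.Gamma (ν + 1))⁻¹ * ∫ t, pp ν α β t)) := by
  have hH := H_bound hν hα hβ hL hlip hc0 hM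
  have ha : 0 < α ^ 2 - β ^ 2 := by linarith
  have hr : 0 < 2 * ν + 1 := by linarith
  have i0 := pp_integrable hν hα hβ
  have iw := wpp_integrable hν hα hβ
  have hA := AA_nonneg ν α β hx
  have hB := BB_nonneg α β x hν
  have hU := UU_le hν hα hβ hx
  have hAB := AQBP β hν hα hx
  have hw : ∀ t, ww ν α β t = (α ^ 2 - β ^ 2) * (t - (2 * ν + 1) * β / (α ^ 2 - β ^ 2)) := by
    intro t; unfold ww; field_simp
  set a := α ^ 2 - β ^ 2
  set m := (2 * ν + 1) * β / a with hm
  set c := √((2 * ν + 1) / a * (1 + 2 * β ^ 2 / a)) with hcdef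
  have hc : 0 ≤ c := Real.sqrt_nonneg _
  set M := (Real.Gamma (ν + 1))⁻¹ * ∫ t, pp ν α β t with hMdef
  have hHt : ∀ t, 0 ≤ t → |h t - c0| ≤ L / a * ww ν α β t + L * (2 * |m| + c) := by
    intro t ht
    refine (hH t).trans ?_
    have h1 : |t - m| ≤ (t - m) + 2 * |m| := by
      rw [abs_le]; constructor <;> linarith [le_abs_self m, abs_nonneg m]
    rw [hw]
    have : L / a * (a * (t - m)) = L * (t - m) := by field_simp
    rw [this]
    nlinarith [mul_le_mul_of_nonneg_left h1 hL]
  have hcont := lip_cont hlip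
  have iq1 := qq_intervalIntegrable α β hν (fun t => ww ν α β t) (ww_cont ν α β) 0 x
  have iq0 : IntervalIntegrable (qq ν α β) volume 0 x := by
    simpa using qq_intervalIntegrable α β hν (fun _ => 1) continuous_const 0 x
  have q1 : |∫ t in (0:ℝ)..x, qq ν α β t * (h t - c0)| ≤
      L / a * QQ ν α β x + L * (2 * |m| + c) * ∫ t in (0:ℝ)..x, qq ν α β t := by
    rw [← int_wqq α β hν hx, ← intervalIntegral.integral_const_mul, ← intervalIntegral.integral_const_mul,
      ← intervalIntegral.integral_add (iq1.const_mul _) (iq0.const_mul _)]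
    rw [← Real.norm_eq_abs]
    refine intervalIntegral.norm_integral_le_of_norm_le hx.le
      (Eventually.of_forall fun t ht => ?_) (by exact (iq1.const_mul _).add (iq0.const_mul _))
    have hq := qq_nonneg α β hν ht.1.le
    rw [norm_mul, Real.norm_eq_abs, Real.norm_eq_abs, abs_of_nonneg hq]
    have := mul_le_mul_of_nonneg_left (hHt t ht.1.le) hq
    linarith
  have p1 : |∫ t in Set.Ioi x, pp ν α β t * (h t - c0)| ≤
      L / a * PP ν α β x + L * (2 * |m| + c) * ∫ t in Set.Ioi x, pp ν α β t := by
    rw [← int_wpp hν hα hβ hx, ← integral_const_mul, ← integral_const_mul,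
      ← integral_add (iw.integrableOn.const_mul _) (i0.integrableOn.const_mul _)]
    rw [← Real.norm_eq_abs]
    refine norm_integral_le_of_norm_le
      (by exact (iw.integrableOn.const_mul _).add (i0.integrableOn.const_mul _))
      ((ae_restrict_iff' measurableSet_Ioi).2 (Eventually.of_forall fun t ht => ?_))
    have hp := pp_nonneg ν α β t
    rw [norm_mul, Real.norm_eq_abs, Real.norm_eq_abs, abs_of_nonneg hp]
    have := mul_le_mul_of_nonneg_left (hHt t (hx.trans ht).le) hp
    linarith
  refine (abs_add_le _ _).trans ?_
  rw [abs_mul, abs_mul, abs_of_nonneg hA, abs_of_nonneg hB]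
  have k1 := mul_le_mul_of_nonneg_left q1 hA
  have k2 := mul_le_mul_of_nonneg_left p1 hB
  have k3 := mul_le_mul_of_nonneg_left hU (show 0 ≤ L * (2 * |m| + c) by positivity)
  unfold UU at k3
  have k4 : L / a * (AA ν α β x * QQ ν α β x + BB ν α β x * PP ν α β x) = L * (2 / a) := by
    rw [hAB]; ring
  linarith


lemma kk_eq (ν β : ℝ) {α t : ℝ} (hα : 0 < α) (ht : t ≠ 0) :
    Real.exp (β * t) * |t| ^ ν * besselK ν (α * |t|) = (1/2) * (α / 2) ^ (-ν) * pp ν α β t := by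
  have h : 0 < |t| := abs_pos.2 ht
  rw [besselK_eq ν (by positivity : 0 < α * |t|), mul_pow, sq_abs,
    show α * |t| / 2 = (α / 2) * |t| by ring, Real.mul_rpow (by positivity) h.le]
  have e : |t| ^ ν * |t| ^ (-ν) = 1 := by rw [← Real.rpow_add h]; simp
  unfold pp
  linear_combination (Real.exp (β * t) * (1/2) * (α / 2) ^ (-ν) * jj ν (α ^ 2 * t ^ 2 / 4)) * e

lemma ii_eq (ν β : ℝ) {α t : ℝ} (hα : 0 < α) (ht : 0 < t) :
    Real.exp (β * t) * |t| ^ ν * besselI ν (α * |t|) = (α / 2) ^ ν * qq ν α β t := by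
  rw [abs_of_pos ht, besselI_eq ν (by positivity : 0 < α * t), mul_pow,
    show α * t / 2 = (α / 2) * t by ring, Real.mul_rpow (by positivity) ht.le]
  have e : t ^ ν * t ^ ν = t ^ (2 * ν) := by rw [← Real.rpow_add ht]; congr 1; ring
  unfold qq
  linear_combination (Real.exp (β * t) * (α / 2) ^ ν * gg ν (α ^ 2 * t ^ 2 / 4)) * e

lemma aa_eq (ν β : ℝ) {α x σ : ℝ} (hα : 0 < α) (hx : 0 < x) :
    Real.exp (-β * x) * besselK ν (α * |x|) / (σ ^ 2 * |x| ^ ν) =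
      (1 / σ ^ 2) * (1/2) * (α / 2) ^ (-ν) * AA ν α β x := by
  rw [abs_of_pos hx, besselK_eq ν (by positivity : 0 < α * x), mul_pow,
    show α * x / 2 = (α / 2) * x by ring, Real.mul_rpow (by positivity) hx.le]
  have e : x ^ (-ν) / x ^ ν = x ^ (-(2 * ν)) := by rw [← Real.rpow_sub hx]; congr 1; ring
  unfold AA
  rw [← e, neg_mul]
  ring

lemma bb_eq (ν β : ℝ) {α x σ : ℝ} (hα : 0 < α) (hx : 0 < x) :
    Real.exp (-β * x) * besselI ν (α * |x|) / (σ ^ 2 * |x| ^ ν) =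
      (1 / σ ^ 2) * (α / 2) ^ ν * BB ν α β x := by
  rw [abs_of_pos hx, besselI_eq ν (by positivity : 0 < α * x), mul_pow,
    show α * x / 2 = (α / 2) * x by ring, Real.mul_rpow (by positivity) hx.le]
  have e : x ^ ν / x ^ ν = 1 := div_self (by positivity)
  unfold BB
  rw [neg_mul]
  linear_combination ((1 / σ ^ 2) * (α / 2) ^ ν * Real.exp (-(β * x)) * gg ν (α ^ 2 * x ^ 2 / 4)) * e

lemma par_alpha (θ : ℝ) {σ : ℝ} (hσ : 0 < σ) : 0 < √(θ ^ 2 + σ ^ 2) / σ ^ 2 := by positivity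

lemma par_a (θ : ℝ) {σ : ℝ} (hσ : 0 < σ) :
    (√(θ ^ 2 + σ ^ 2) / σ ^ 2) ^ 2 - (θ / σ ^ 2) ^ 2 = 1 / σ ^ 2 := by
  rw [div_pow, Real.sq_sqrt (by positivity)]
  field_simp; ring

lemma par_lt (θ : ℝ) {σ : ℝ} (hσ : 0 < σ) :
    (θ / σ ^ 2) ^ 2 < (√(θ ^ 2 + σ ^ 2) / σ ^ 2) ^ 2 := by
  have := par_a θ hσ
  have : 0 < 1 / σ ^ 2 := by positivity
  linarith

lemma par_ratio (θ : ℝ) {σ : ℝ} (hσ : 0 < σ) :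
    (√(θ ^ 2 + σ ^ 2) / σ ^ 2) ^ 2 / ((√(θ ^ 2 + σ ^ 2) / σ ^ 2) ^ 2 - (θ / σ ^ 2) ^ 2) =
      1 + θ ^ 2 / σ ^ 2 := by
  rw [par_a θ hσ, div_pow, Real.sq_sqrt (by positivity)]
  field_simp; ring

lemma par_sqrt (θ : ℝ) {σ : ℝ} (hσ : 0 < σ) :
    √(θ ^ 2 + σ ^ 2) = σ * √(1 + θ ^ 2 / σ ^ 2) := by
  rw [← Real.sqrt_sq hσ.le, ← Real.sqrt_mul (by positivity), Real.sqrt_sq hσ.le]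
  congr 1; field_simp; ring

lemma M_eq {r : ℝ} (θ : ℝ) {σ : ℝ} (hr : 0 < r) (hσ : 0 < σ) :
    ∫ t, pp ((r - 1) / 2) (√(θ ^ 2 + σ ^ 2) / σ ^ 2) (θ / σ ^ 2) t =
      2 * √π * σ * Real.Gamma (r / 2) * (1 + θ ^ 2 / σ ^ 2) ^ ((r - 1) / 2) := by
  have := (mass (ν := (r-1)/2) (by linarith) (par_alpha θ hσ) (par_lt θ hσ)).2
  rw [par_ratio θ hσ] at this
  unfold pp
  rw [this, par_sqrt θ hσ]
  have hb : 0 < 1 + θ ^ 2 / σ ^ 2 := by positivity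
  set b := 1 + θ ^ 2 / σ ^ 2
  rw [Real.rpow_add hb, ← Real.sqrt_eq_rpow, show (r-1)/2 + 1/2 = r/2 by ring]
  have : 0 < √b := Real.sqrt_pos.2 hb
  field_simp

lemma vg_eq {r : ℝ} (θ : ℝ) {σ : ℝ} (hr : 0 < r) (hσ : 0 < σ) {t : ℝ} (ht : t ≠ 0) :
    vgDensity r θ σ t =
      (∫ t, pp ((r - 1) / 2) (√(θ ^ 2 + σ ^ 2) / σ ^ 2) (θ / σ ^ 2) t)⁻¹ *
      pp ((r - 1) / 2) (√(θ ^ 2 + σ ^ 2) / σ ^ 2) (θ / σ ^ 2) t := by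
  have hα := par_alpha θ hσ
  have k := kk_eq ((r-1)/2) (θ / σ ^ 2) hα ht
  have h : 0 < |t| := abs_pos.2 ht
  have hs : 0 < √(θ ^ 2 + σ ^ 2) := by positivity
  have hb : 0 < 1 + θ ^ 2 / σ ^ 2 := by positivity
  have hG := Real.Gamma_pos_of_pos (show 0 < r/2 by linarith)
  rw [M_eq θ hr hσ]
  unfold vgDensity
  rw [show √(θ ^ 2 + σ ^ 2) * |t| / σ ^ 2 = √(θ ^ 2 + σ ^ 2) / σ ^ 2 * |t| by ring,
    show θ * t / σ ^ 2 = θ / σ ^ 2 * t by ring, Real.div_rpow h.le (by positivity)]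
  have e : (√(θ ^ 2 + σ ^ 2) / σ ^ 2 / 2) ^ (-((r - 1) / 2)) / (2 * √(θ ^ 2 + σ ^ 2)) ^ ((r - 1) / 2) =
      ((1 + θ ^ 2 / σ ^ 2) ^ ((r - 1) / 2))⁻¹ := by
    rw [Real.rpow_neg (by positivity), div_eq_mul_inv, ← mul_inv, ← Real.mul_rpow (by positivity) (by positivity)]
    congr 2
    have := Real.mul_self_sqrt (show 0 ≤ θ ^ 2 + σ ^ 2 by positivity)
    field_simp
    nlinarith
  calc _ = (σ * √π * Real.Gamma (r / 2))⁻¹ / (2 * √(θ ^ 2 + σ ^ 2)) ^ ((r - 1) / 2) *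
        (Real.exp (θ / σ ^ 2 * t) * |t| ^ ((r - 1) / 2) *
          besselK ((r - 1) / 2) (√(θ ^ 2 + σ ^ 2) / σ ^ 2 * |t|)) := by ring
    _ = (σ * √π * Real.Gamma (r / 2))⁻¹ * (1/2) *
        ((√(θ ^ 2 + σ ^ 2) / σ ^ 2 / 2) ^ (-((r - 1) / 2)) / (2 * √(θ ^ 2 + σ ^ 2)) ^ ((r - 1) / 2)) *
        pp ((r - 1) / 2) (√(θ ^ 2 + σ ^ 2) / σ ^ 2) (θ / σ ^ 2) t := by rw [k]; ring
    _ = _ := by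
      rw [e, ← one_div, ← one_div, ← one_div]
      congr 1
      rw [div_mul_div_comm, div_mul_div_comm]
      congr 1 <;> ring

lemma M_pos {r : ℝ} (θ : ℝ) {σ : ℝ} (hr : 0 < r) (hσ : 0 < σ) :
    0 < ∫ t, pp ((r - 1) / 2) (√(θ ^ 2 + σ ^ 2) / σ ^ 2) (θ / σ ^ 2) t := by
  rw [M_eq θ hr hσ]
  have hG := Real.Gamma_pos_of_pos (show 0 < r/2 by linarith)
  have := Real.pi_pos
  positivity

lemma ae_ne_zero : ∀ᵐ t : ℝ, t ≠ 0 := by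
  rw [ae_iff]; simp

lemma c0_eq {r : ℝ} (θ : ℝ) {σ : ℝ} (hr : 0 < r) (hσ : 0 < σ) (h : ℝ → ℝ) :
    (∫ t, h t * vgDensity r θ σ t) *
      ∫ t, pp ((r - 1) / 2) (√(θ ^ 2 + σ ^ 2) / σ ^ 2) (θ / σ ^ 2) t =
    ∫ t, h t * pp ((r - 1) / 2) (√(θ ^ 2 + σ ^ 2) / σ ^ 2) (θ / σ ^ 2) t := by
  have hM := M_pos θ hr hσ
  set M := ∫ t, pp ((r - 1) / 2) (√(θ ^ 2 + σ ^ 2) / σ ^ 2) (θ / σ ^ 2) t with hMd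
  rw [← integral_mul_const]
  refine integral_congr_ae ?_
  filter_upwards [ae_ne_zero] with t ht
  rw [vg_eq θ hr hσ ht, ← hMd]
  field_simp

lemma stein_pos {r : ℝ} (θ : ℝ) {σ : ℝ} (hσ : 0 < σ) (h : ℝ → ℝ) {x : ℝ} (hx : 0 < x) :
    steinSolution r θ σ h x = -(1 / (2 * σ ^ 2)) *
      (AA ((r - 1) / 2) (√(θ ^ 2 + σ ^ 2) / σ ^ 2) (θ / σ ^ 2) x *
        (∫ t in (0:ℝ)..x, qq ((r - 1) / 2) (√(θ ^ 2 + σ ^ 2) / σ ^ 2) (θ / σ ^ 2) t *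
          (h t - ∫ t, h t * vgDensity r θ σ t)) +
      BB ((r - 1) / 2) (√(θ ^ 2 + σ ^ 2) / σ ^ 2) (θ / σ ^ 2) x *
        (∫ t in Set.Ioi x, pp ((r - 1) / 2) (√(θ ^ 2 + σ ^ 2) / σ ^ 2) (θ / σ ^ 2) t *
          (h t - ∫ t, h t * vgDensity r θ σ t))) := by
  have hα := par_alpha θ hσ
  unfold steinSolution htilde
  generalize (∫ t, h t * vgDensity r θ σ t) = c0
  set α := √(θ ^ 2 + σ ^ 2) / σ ^ 2
  set β := θ / σ ^ 2
  set ν := (r - 1) / 2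
  rw [aa_eq ν β hα hx, bb_eq ν β hα hx]
  have e1 : ∫ t in (0:ℝ)..x, Real.exp (β * t) * |t| ^ ν * besselI ν (α * |t|) * (h t - c0) =
      (α / 2) ^ ν * ∫ t in (0:ℝ)..x, qq ν α β t * (h t - c0) := by
    rw [← intervalIntegral.integral_const_mul]
    refine intervalIntegral.integral_congr_ae (Eventually.of_forall fun t ht => ?_)
    rw [Set.uIoc_of_le hx.le] at ht
    rw [ii_eq ν β hα ht.1]; ring
  have e2 : ∫ t in Set.Ioi x, Real.exp (β * t) * |t| ^ ν * besselK ν (α * |t|) * (h t - c0) =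
      (1/2) * (α / 2) ^ (-ν) * ∫ t in Set.Ioi x, pp ν α β t * (h t - c0) := by
    rw [← integral_const_mul]
    refine setIntegral_congr_fun measurableSet_Ioi fun t ht => ?_
    have ht' : x < t := ht
    rw [kk_eq ν β hα (by linarith)]; ring
  rw [e1, e2]
  have e3 : (α / 2) ^ ν * (α / 2) ^ (-ν) = 1 := by
    rw [← Real.rpow_add (by positivity)]; simp
  generalize (∫ t in (0:ℝ)..x, qq ν α β t * (h t - c0)) = I1
  generalize (∫ t in Set.Ioi x, pp ν α β t * (h t - c0)) = I2
  linear_combination (-(1 / σ ^ 2 * (1/2)) * (AA ν α β x * I1 + BB ν α β x * I2)) * e3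

lemma bound_pos {r θ σ : ℝ} (hr : 0 < r) (hσ : 0 < σ)
    {h : ℝ → ℝ} {L : ℝ} (hL : 0 ≤ L) (hlip : ∀ u v : ℝ, |h u - h v| ≤ L * |u - v|) {x : ℝ} (hx : 0 < x) :
      |steinSolution r θ σ h x| ≤
        (4 + 2 * Real.sqrt 2 / Real.sqrt r +
          Real.sqrt (2 * Real.pi * (r + 1)) * (|θ| / σ) * (1 + θ ^ 2 / σ ^ 2) ^ ((r - 1) / 2) +
          (Real.sqrt (2 * r) + r) * Aconst r θ σ) * L := by
  have hm := main_abs (ν := (r-1)/2) (by linarith) (par_alpha θ hσ) (par_lt θ hσ) hL hlip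
    (c0_eq θ hr hσ h) (M_pos θ hr hσ) hx
  have hf := mul_le_mul_of_nonneg_right (final_ineq θ hr hσ) hL
  refine le_trans ?_ hf
  rw [stein_pos θ hσ h hx, abs_mul, abs_neg, abs_of_nonneg (by positivity)]
  refine (mul_le_mul_of_nonneg_left hm (by positivity)).trans (le_of_eq ?_)
  rw [par_a θ hσ, M_eq θ hr hσ, show 2 * ((r-1)/2) + 1 = r by ring, show (r-1)/2 + 1 = (r+1)/2 by ring]
  rw [show r * (θ / σ ^ 2) / (1 / σ ^ 2) = r * θ by field_simp,
    show r / (1 / σ ^ 2) * (1 + 2 * (θ / σ ^ 2) ^ 2 / (1 / σ ^ 2)) = r * (σ ^ 2 + 2 * θ ^ 2) by field_simp,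
    abs_mul, abs_of_pos hr]
  unfold Gc
  field_simp

lemma vg_neg (r θ σ t : ℝ) : vgDensity r (-θ) σ (-t) = vgDensity r θ σ t := by
  unfold vgDensity; simp

lemma c0_neg (r θ σ : ℝ) (h : ℝ → ℝ) :
    ∫ t, h (-t) * vgDensity r (-θ) σ t = ∫ t, h t * vgDensity r θ σ t := by
  rw [← integral_neg_eq_self]
  simp only [neg_neg, vg_neg]

lemma kint_zero {r θ σ : ℝ} (hr : 0 < r) (hσ : 0 < σ)
    {h : ℝ → ℝ} {L : ℝ} (hlip : ∀ u v : ℝ, |h u - h v| ≤ L * |u - v|) :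
    Integrable (fun t => Real.exp ((θ / σ ^ 2) * t) * |t| ^ ((r - 1) / 2) *
      besselK ((r - 1) / 2) (Real.sqrt (θ ^ 2 + σ ^ 2) / σ ^ 2 * |t|) * htilde r θ σ h t) ∧
    ∫ t, Real.exp ((θ / σ ^ 2) * t) * |t| ^ ((r - 1) / 2) *
      besselK ((r - 1) / 2) (Real.sqrt (θ ^ 2 + σ ^ 2) / σ ^ 2 * |t|) * htilde r θ σ h t = 0 := by
  have hα := par_alpha θ hσ
  have hβ := par_lt θ hσ
  have c0 := c0_eq θ hr hσ h
  unfold htilde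
  generalize (∫ t, h t * vgDensity r θ σ t) = c at *
  set α := √(θ ^ 2 + σ ^ 2) / σ ^ 2
  set β := θ / σ ^ 2
  have hν : -(1/2) < (r - 1) / 2 := by linarith
  set ν := (r - 1) / 2
  have i1 := hpp_integrable hν hα hβ hlip
  have i0 := pp_integrable hν hα hβ
  have i2 : Integrable (fun t => (1/2) * (α / 2) ^ (-ν) * (h t * pp ν α β t - c * pp ν α β t)) :=
    (i1.sub (i0.const_mul c)).const_mul _
  have e : (fun t => (1/2) * (α / 2) ^ (-ν) * (h t * pp ν α β t - c * pp ν α β t)) =ᵐ[volume]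
      fun t => Real.exp (β * t) * |t| ^ ν * besselK ν (α * |t|) * (h t - c) := by
    filter_upwards [ae_ne_zero] with t ht
    rw [kk_eq ν β hα ht]; ring
  refine ⟨i2.congr e, ?_⟩
  rw [← integral_congr_ae e, integral_const_mul, integral_sub i1 (i0.const_mul c), integral_const_mul, c0]
  simp

lemma stein_neg {r θ σ : ℝ} (hr : 0 < r) (hσ : 0 < σ)
    {h : ℝ → ℝ} {L : ℝ} (hlip : ∀ u v : ℝ, |h u - h v| ≤ L * |u - v|) (x : ℝ) :
    steinSolution r θ σ h x = -steinSolution r (-θ) σ (fun t => h (-t)) (-x) := by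
  obtain ⟨ki, k0⟩ := kint_zero (θ := θ) hr hσ hlip
  have ht : ∀ t, htilde r (-θ) σ (fun t => h (-t)) t = htilde r θ σ h (-t) := by
    intro t; unfold htilde; rw [c0_neg]
  unfold steinSolution
  simp only [ht, abs_neg, neg_sq]
  have e1 := intervalIntegral.integral_comp_neg (a := 0) (b := -x) (fun t => Real.exp ((θ / σ ^ 2) * t) * |t| ^ ((r - 1) / 2) *
      besselI ((r - 1) / 2) (Real.sqrt (θ ^ 2 + σ ^ 2) / σ ^ 2 * |t|) * htilde r θ σ h t)
  have e2 := integral_comp_neg_Ioi (-x) (fun t => Real.exp ((θ / σ ^ 2) * t) * |t| ^ ((r - 1) / 2) *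
      besselK ((r - 1) / 2) (Real.sqrt (θ ^ 2 + σ ^ 2) / σ ^ 2 * |t|) * htilde r θ σ h t)
  rw [neg_neg, neg_zero] at e1
  replace e1 := e1.trans (intervalIntegral.integral_symm 0 x)
  rw [neg_neg] at e2
  have e3 := intervalIntegral.integral_Iic_add_Ioi (b := x) ki.integrableOn ki.integrableOn
  rw [k0] at e3
  have e4 : ∀ t, -θ / σ ^ 2 * t = θ / σ ^ 2 * -t := by intro t; ring
  have e5 : -(-θ / σ ^ 2) * -x = -(θ / σ ^ 2) * x := by ring
  simp only [abs_neg] at e1 e2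
  simp only [e4, e5]
  rw [e1, e2, eq_neg_of_add_eq_zero_left e3]
  ring

theorem stein_factor_f_lipschitz (r θ σ : ℝ) (hr : 0 < r) (hσ : 0 < σ)
    (h : ℝ → ℝ) (L : ℝ) (hL : 0 ≤ L) (hlip : ∀ u v : ℝ, |h u - h v| ≤ L * |u - v|) :
    ∀ x : ℝ, x ≠ 0 →
      |steinSolution r θ σ h x| ≤
        (4 + 2 * Real.sqrt 2 / Real.sqrt r +
          Real.sqrt (2 * Real.pi * (r + 1)) * (|θ| / σ) * (1 + θ ^ 2 / σ ^ 2) ^ ((r - 1) / 2) +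
          (Real.sqrt (2 * r) + r) * Aconst r θ σ) * L := by
  intro x hx
  rcases lt_or_gt_of_ne hx with h0 | h0
  · have hl : ∀ u v : ℝ, |h (-u) - h (-v)| ≤ L * |u - v| := by
      intro u v
      have h1 := hlip (-u) (-v)
      rwa [show -u - -v = -(u - v) by ring, abs_neg] at h1
    have hb := bound_pos (θ := -θ) hr hσ hL hl (neg_pos.2 h0)
    rw [stein_neg hr hσ hlip x, abs_neg]
    have hA : Aconst r (-θ) σ = Aconst r θ σ := by unfold Aconst; simp
    rw [abs_neg, neg_sq, hA] at hb
    exact hb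
  · exact bound_pos hr hσ hL hlip h0
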